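/- There is an absolute constant C > 0 such that the following holds. Consider RLS on the mirrored-profit instance of the chance-constrained knapsack problem with correlated uniform weights, for any K, m ≥ 1 (n = K·m), any a, d, c > 0, B > 0, 0 < α < 1, and any profits satisfying the mirrored-profit condition. For every initial solution x₀ ∈ {0,1}^n, the expected number of iterations until the current solution is, for the first time, a feasible solution of maximal profit among all feasible solutions is at most C·n³. -/

import Mathlib

open Finset
open scoped ENNReal

noncomputable section

/-- Number of one-bits (selected items) of a solution. -/
def numOnes (K m : ℕ) (x : Fin K → Fin m → Bool) : ℕ :=
  ∑ i, ∑ j, if x i j then 1 else 0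

/-- Covariance contribution `2c·Σᵢ Σ_{j1<j2} x_{ij1}·x_{ij2}` of a solution. -/
def cova (K m : ℕ) (c : ℝ) (x : Fin K → Fin m → Bool) : ℝ :=
  2 * c * ∑ i, ∑ p ∈ Finset.univ.filter (fun p : Fin m × Fin m => p.1 < p.2),
      (if x i p.1 then (1 : ℝ) else 0) * (if x i p.2 then (1 : ℝ) else 0)

/-- Expected weight `E[W(x)] = a·|x|₁`. -/
def expWeight (K m : ℕ) (a : ℝ) (x : Fin K → Fin m → Bool) : ℝ :=
  a * (numOnes K m x : ℝ)

/-- Variance `Var[W(x)] = d·|x|₁ + 2c·Σᵢ Σ_{j1<j2} x_{ij1}·x_{ij2}`. -/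
def varWeight (K m : ℕ) (d c : ℝ) (x : Fin K → Fin m → Bool) : ℝ :=
  d * (numOnes K m x : ℝ) + cova K m c x

/-- Chebyshev surrogate `β(x) = Var[W(x)] / (Var[W(x)] + (B − E[W(x)])²)`. -/
def chebBeta (K m : ℕ) (a d c B : ℝ) (x : Fin K → Fin m → Bool) : ℝ :=
  varWeight K m d c x / (varWeight K m d c x + (B - expWeight K m a x) ^ 2)

/-- A solution is feasible if `E[W(x)] < B` and `β(x) ≤ α`. -/
def feasible (K m : ℕ) (a d c B α : ℝ) (x : Fin K → Fin m → Bool) : Prop :=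
  expWeight K m a x < B ∧ chebBeta K m a d c B x ≤ α

/-- `β'(x) = β(x)` if `E[W(x)] < B`, and `β'(x) = 1 + E[W(x)] − B` otherwise. -/
def betaPrime (K m : ℕ) (a d c B : ℝ) (x : Fin K → Fin m → Bool) : ℝ :=
  if expWeight K m a x < B then chebBeta K m a d c B x else 1 + expWeight K m a x - B

/-- Total profit `p(x) = Σᵢⱼ p_{ij}·x_{ij}`. -/
def profitOf (K m : ℕ) (profit : Fin K → Fin m → ℝ) (x : Fin K → Fin m → Bool) : ℝ :=
  ∑ i, ∑ j, if x i j then profit i j else 0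

/-- `p'(x) = −1` if `β'(x) > α`, and `p'(x) = p(x)` otherwise. -/
def pPrime (K m : ℕ) (a d c B α : ℝ) (profit : Fin K → Fin m → ℝ)
    (x : Fin K → Fin m → Bool) : ℝ :=
  if α < betaPrime K m a d c B x then -1 else profitOf K m profit x

/-- Lexicographic fitness dominance: `f(y) ⪰ f(x)` iff `p'(y) > p'(x)`, or
`p'(y) = p'(x)` and `β'(y) ≤ β'(x)`. -/
def fge (K m : ℕ) (a d c B α : ℝ) (profit : Fin K → Fin m → ℝ)
    (y x : Fin K → Fin m → Bool) : Prop :=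
  pPrime K m a d c B α profit x < pPrime K m a d c B α profit y ∨
    (pPrime K m a d c B α profit y = pPrime K m a d c B α profit x ∧
      betaPrime K m a d c B y ≤ betaPrime K m a d c B x)

/-- Hamming distance between two solutions. -/
def hdist (K m : ℕ) (x y : Fin K → Fin m → Bool) : ℕ :=
  ∑ i, ∑ j, if x i j = y i j then 0 else 1

/-- Standard-bit mutation of the (1+1) EA: each bit flips independently with
probability `1/n`, so `y` is produced from `x` with probability
`(1/n)^{H(x,y)}·(1 − 1/n)^{n − H(x,y)}`. -/
def mutEA (K m : ℕ) (x y : Fin K → Fin m → Bool) : ℝ≥0∞ :=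
  (1 / (K * m : ℝ≥0∞)) ^ hdist K m x y *
    (1 - 1 / (K * m : ℝ≥0∞)) ^ (K * m - hdist K m x y)

/-- RLS mutation: with probability `1/2` flip one uniformly random bit, with probability
`1/2` flip a uniformly random pair of distinct bits; so a one-bit-flip neighbour is
produced with probability `1/(2n)` and a two-bit-flip neighbour with probability
`1/(n(n−1))`. -/
def mutRLS (K m : ℕ) (x y : Fin K → Fin m → Bool) : ℝ≥0∞ :=
  if hdist K m x y = 1 then 1 / (2 * (K * m : ℝ≥0∞))
  else if hdist K m x y = 2 then 1 / ((K * m : ℝ≥0∞) * ((K * m : ℝ≥0∞) - 1))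
  else 0

open scoped Classical in
/-- One-step transition probability of an elitist algorithm with mutation distribution
`mutD` and acceptance relation `acc y x` (= "`f(y) ⪰ f(x)`"): the offspring is accepted
iff `acc`, otherwise the algorithm stays at `x`. -/
def stepP (K m : ℕ)
    (mutD : (Fin K → Fin m → Bool) → (Fin K → Fin m → Bool) → ℝ≥0∞)
    (acc : (Fin K → Fin m → Bool) → (Fin K → Fin m → Bool) → Prop)
    (x y : Fin K → Fin m → Bool) : ℝ≥0∞ :=
  (if acc y x then mutD x y else 0) +
    (if y = x then ∑ z, (if acc z x then 0 else mutD x z) else 0)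

open scoped Classical in
/-- `hitVec K m P A x₀ t y` is the probability that the Markov chain with transition
matrix `P` started at `x₀` has not visited the target set `A` during the first `t` steps
and is currently at `y`. -/
def hitVec (K m : ℕ)
    (P : (Fin K → Fin m → Bool) → (Fin K → Fin m → Bool) → ℝ≥0∞)
    (A : (Fin K → Fin m → Bool) → Prop) (x₀ : Fin K → Fin m → Bool) :
    ℕ → (Fin K → Fin m → Bool) → ℝ≥0∞
  | 0 => fun y => if y = x₀ ∧ ¬ A y then 1 else 0
  | (t + 1) => fun y => if A y then 0 else ∑ x, hitVec K m P A x₀ t x * P x y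

/-- Expected hitting time `E[min {t : X_t ∈ A}]` of the target set `A` for the Markov
chain with transition matrix `P` started at `x₀`, computed as `Σ_{t≥0} Pr(T > t)`. -/
def expHitTime (K m : ℕ)
    (P : (Fin K → Fin m → Bool) → (Fin K → Fin m → Bool) → ℝ≥0∞)
    (A : (Fin K → Fin m → Bool) → Prop) (x₀ : Fin K → Fin m → Bool) : ℝ≥0∞ :=
  ∑' t : ℕ, ∑ y, hitVec K m P A x₀ t y

/-- Covariance `s_ℓ^b` of a balanced solution with `ℓ` one-bits: with `q = ⌊ℓ/K⌋` and
`t = ℓ − qK`, it is `c·[(K − t)·q(q − 1) + t·(q + 1)q]`. -/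
def balCov (K : ℕ) (c : ℝ) (ℓ : ℕ) : ℝ :=
  c * (((K - (ℓ - (ℓ / K) * K)) * ((ℓ / K) * (ℓ / K - 1)) +
        (ℓ - (ℓ / K) * K) * ((ℓ / K + 1) * (ℓ / K)) : ℕ) : ℝ)

/-- The solution obtained from `y` by setting bit `(i, j)` to one. -/
def flipUp (K m : ℕ) (y : Fin K → Fin m → Bool) (i : Fin K) (j : Fin m) :
    Fin K → Fin m → Bool :=
  fun i' j' => if i' = i ∧ j' = j then true else y i' j'

end
set_option linter.unusedSimpArgs false

theorem hit_drift (K m : ℕ)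
    (P : (Fin K → Fin m → Bool) → (Fin K → Fin m → Bool) → ℝ≥0∞)
    (A : (Fin K → Fin m → Bool) → Prop) (Φ : (Fin K → Fin m → Bool) → ℝ≥0∞)
    (h : ∀ x, ¬ A x → ∑ y, P x y * Φ y + 1 ≤ Φ x) (x₀ : Fin K → Fin m → Bool) :
    expHitTime K m P A x₀ ≤ Φ x₀ := by
  classical
  have hA : ∀ t x, A x → hitVec K m P A x₀ t x = 0 := by
    intro t x hx
    cases t <;> simp [hitVec, hx]
  have key : ∀ t, ∑ y, hitVec K m P A x₀ (t+1) y * Φ y + ∑ y, hitVec K m P A x₀ t y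
      ≤ ∑ y, hitVec K m P A x₀ t y * Φ y := by
    intro t
    have h1 : ∑ y, hitVec K m P A x₀ (t+1) y * Φ y
        ≤ ∑ x, hitVec K m P A x₀ t x * ∑ y, P x y * Φ y := by
      calc ∑ y, hitVec K m P A x₀ (t+1) y * Φ y
          ≤ ∑ y, (∑ x, hitVec K m P A x₀ t x * P x y) * Φ y := by
            refine Finset.sum_le_sum fun y _ => ?_
            gcongr
            simp only [hitVec]
            split_ifs <;> simp
        _ = _ := by
            simp_rw [Finset.sum_mul, Finset.mul_sum]
            rw [Finset.sum_comm]
            simp_rw [mul_assoc]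
    calc _ ≤ ∑ x, hitVec K m P A x₀ t x * (∑ y, P x y * Φ y) + ∑ y, hitVec K m P A x₀ t y := by
            gcongr
      _ = ∑ x, hitVec K m P A x₀ t x * (∑ y, P x y * Φ y + 1) := by
            rw [← Finset.sum_add_distrib]
            simp_rw [mul_add, mul_one]
      _ ≤ _ := by
            refine Finset.sum_le_sum fun x _ => ?_
            by_cases hx : A x
            · simp [hA t x hx]
            · gcongr
              exact h x hx
  have part : ∀ n, ∑ t ∈ Finset.range n, ∑ y, hitVec K m P A x₀ t y
      + ∑ y, hitVec K m P A x₀ n y * Φ y ≤ Φ x₀ := by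
    intro n
    induction n with
    | zero =>
      simp only [Finset.range_zero, Finset.sum_empty, zero_add, hitVec]
      calc _ ≤ ∑ y, (if y = x₀ then Φ y else 0) := by
            refine Finset.sum_le_sum fun y _ => ?_
            by_cases h1 : y = x₀
            · subst h1; by_cases h2 : A y <;> simp [h2]
            · simp [h1]
        _ = _ := by simp
    | succ n ih =>
      rw [Finset.sum_range_succ]
      refine le_trans ?_ ih
      rw [add_assoc]
      gcongr
      rw [add_comm]
      exact key n
  unfold expHitTime
  refine ENNReal.tsum_le_of_sum_range_le fun n => ?_
  exact le_trans le_self_add (part n)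

/-- flip one bit -/
def fl {K m : ℕ} (x : Fin K → Fin m → Bool) (p : Fin K × Fin m) : Fin K → Fin m → Bool :=
  fun i j => if (i, j) = p then !(x i j) else x i j

/-- difference set -/
def dfs {K m : ℕ} (x y : Fin K → Fin m → Bool) : Finset (Fin K × Fin m) :=
  Finset.univ.filter fun p => x p.1 p.2 ≠ y p.1 p.2

theorem hdist_eq {K m : ℕ} (x y : Fin K → Fin m → Bool) : hdist K m x y = (dfs x y).card := by
  unfold hdist dfs
  rw [Finset.card_filter, ← Finset.univ_product_univ, Finset.sum_product]
  refine Finset.sum_congr rfl fun i _ => Finset.sum_congr rfl fun j _ => ?_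
  by_cases h : x i j = y i j <;> simp [h]

theorem fl_eq_iff {K m : ℕ} (x y : Fin K → Fin m → Bool) (p : Fin K × Fin m) :
    fl x p = y ↔ dfs x y = {p} := by
  constructor
  · rintro rfl
    ext ⟨i, j⟩
    by_cases h : (i, j) = p <;> simp [dfs, fl, h]
  · intro h
    funext i j
    have := Finset.ext_iff.mp h (i, j)
    simp only [dfs, Finset.mem_filter, Finset.mem_univ, true_and, Finset.mem_singleton] at this
    unfold fl
    by_cases h2 : (i, j) = p
    · have h3 := this.mpr h2
      simp only [h2, if_true]
      revert h3; cases x i j <;> cases y i j <;> simp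
    · simp only [h2, if_false]
      by_contra h3
      exact h2 (this.mp h3)

theorem fl_fl_eq_iff {K m : ℕ} (x y : Fin K → Fin m → Bool) (p q : Fin K × Fin m) (hpq : p ≠ q) :
    fl (fl x p) q = y ↔ dfs x y = {p, q} := by
  constructor
  · rintro rfl
    ext r
    by_cases h : r = p
    · subst h; simp [dfs, fl, hpq]
    · by_cases h' : r = q
      · subst h'; simp [dfs, fl, h]
      · simp [dfs, fl, h, h']
  · intro h
    funext i j
    have := Finset.ext_iff.mp h (i, j)
    simp only [dfs, Finset.mem_filter, Finset.mem_univ, true_and, Finset.mem_singleton,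
      Finset.mem_insert] at this
    unfold fl
    by_cases h1 : (i, j) = p
    · have h3 := this.mpr (Or.inl h1)
      have h2 : (i, j) ≠ q := by rw [h1]; exact hpq
      simp only [h2, h1, if_true, if_false]
      revert h3; cases x i j <;> cases y i j <;> simp [hpq]
    · by_cases h2 : (i, j) = q
      · have h3 := this.mpr (Or.inr h2)
        simp only [h1, if_false, h2, if_true]
        revert h3; cases x i j <;> cases y i j <;> simp [Ne.symm hpq]
      · simp only [h1, h2, if_false]
        by_contra h3
        rcases this.mp h3 with h | h
        · exact h1 h
        · exact h2 h

theorem sum_h1 {K m : ℕ} (x : Fin K → Fin m → Bool) (G : (Fin K → Fin m → Bool) → ℝ) :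
    ∑ y, (if hdist K m x y = 1 then G y else 0) = ∑ p, G (fl x p) := by
  classical
  rw [← Finset.sum_fiberwise (s := (Finset.univ : Finset (Fin K × Fin m))) (g := fun p => fl x p)]
  refine Finset.sum_congr rfl fun y _ => ?_
  rw [Finset.sum_congr rfl (g := fun _ => G y)
    (by intro p hp; simp only [Finset.mem_filter] at hp; rw [hp.2])]
  rw [Finset.sum_const, hdist_eq]
  have : (Finset.univ.filter fun p => fl x p = y).card = if (dfs x y).card = 1 then 1 else 0 := by
    split_ifs with h
    · rw [Finset.card_eq_one] at h
      obtain ⟨p, hp⟩ := h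
      rw [Finset.card_eq_one]
      refine ⟨p, ?_⟩
      ext q
      simp only [Finset.mem_filter, Finset.mem_univ, true_and, Finset.mem_singleton, fl_eq_iff, hp]
      constructor
      · intro h; exact (Finset.singleton_injective h).symm
      · rintro rfl; rfl
    · rw [Finset.card_eq_zero, Finset.filter_eq_empty_iff]
      intro p _ hp
      rw [fl_eq_iff] at hp
      exact h (by rw [hp]; simp)
  rw [this]
  split_ifs <;> simp

theorem sum_h2 {K m : ℕ} (x : Fin K → Fin m → Bool) (G : (Fin K → Fin m → Bool) → ℝ) :
    ∑ y, (if hdist K m x y = 2 then 2 * G y else 0) =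
      ∑ r ∈ (Finset.univ : Finset (Fin K × Fin m)).offDiag, G (fl (fl x r.1) r.2) := by
  classical
  rw [← Finset.sum_fiberwise (g := fun r : (Fin K × Fin m) × (Fin K × Fin m) =>
    fl (fl x r.1) r.2)]
  refine Finset.sum_congr rfl fun y _ => ?_
  rw [Finset.sum_congr rfl (g := fun _ => G y)
    (by intro p hp; simp only [Finset.mem_filter] at hp; rw [hp.2])]
  rw [Finset.sum_const, hdist_eq]
  have : (((Finset.univ : Finset (Fin K × Fin m)).offDiag).filter
      fun r => fl (fl x r.1) r.2 = y).card = if (dfs x y).card = 2 then 2 else 0 := by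
    split_ifs with h
    · have : (((Finset.univ : Finset (Fin K × Fin m)).offDiag).filter
          fun r => fl (fl x r.1) r.2 = y) = (dfs x y).offDiag := by
        ext ⟨p, q⟩
        simp only [Finset.mem_filter, Finset.mem_offDiag, Finset.mem_univ, true_and]
        constructor
        · rintro ⟨h1, h2⟩
          rw [fl_fl_eq_iff _ _ _ _ h1] at h2
          rw [h2]; simp [h1]
        · rintro ⟨h1, h2, h3⟩
          refine ⟨h3, ?_⟩
          rw [fl_fl_eq_iff _ _ _ _ h3]
          symm
          apply Finset.eq_of_subset_of_card_le
          · intro a ha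
            simp only [Finset.mem_insert, Finset.mem_singleton] at ha
            rcases ha with rfl | rfl <;> assumption
          · rw [h, Finset.card_pair h3]
      rw [this, Finset.offDiag_card, h]
    · rw [Finset.card_eq_zero, Finset.filter_eq_empty_iff]
      rintro ⟨p, q⟩ hr hp
      simp only [Finset.mem_offDiag, Finset.mem_univ, true_and] at hr
      rw [fl_fl_eq_iff _ _ _ _ hr] at hp
      exact h (by rw [hp, Finset.card_pair hr])
  rw [this]
  split_ifs <;> simp

noncomputable def muR (K m : ℕ) (x y : Fin K → Fin m → Bool) : ℝ :=
  if hdist K m x y = 1 then 1 / (2 * (K * m : ℝ))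
  else if hdist K m x y = 2 then 1 / ((K * m : ℝ) * ((K * m : ℝ) - 1))
  else 0

theorem card_le_n {K m : ℕ} (x y : Fin K → Fin m → Bool) : hdist K m x y ≤ K * m := by
  rw [hdist_eq]
  refine le_trans (Finset.card_le_univ _) ?_
  simp

theorem muR_nonneg (K m : ℕ) (hK : 1 ≤ K) (hm : 1 ≤ m) (x y : Fin K → Fin m → Bool) :
    0 ≤ muR K m x y := by
  have : (1:ℝ) ≤ K * m := by exact_mod_cast Nat.mul_pos hK hm
  unfold muR
  have : (0:ℝ) ≤ K * m - 1 := by linarith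
  split_ifs <;> positivity

theorem mutRLS_eq (K m : ℕ) (hK : 1 ≤ K) (hm : 1 ≤ m) (x y : Fin K → Fin m → Bool) :
    mutRLS K m x y = ENNReal.ofReal (muR K m x y) := by
  have h1 : 1 ≤ K * m := Nat.mul_pos hK hm
  have hle := card_le_n x y
  have e : ((K:ℝ≥0∞) * (m:ℝ≥0∞)) = ENNReal.ofReal ((K:ℝ) * m) := by
    rw [ENNReal.ofReal_mul (by positivity)]; simp
  have hpos : (0:ℝ) < (K:ℝ) * m := by exact_mod_cast h1
  unfold mutRLS muR
  split_ifs with a b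
  · rw [e, one_div, one_div, ENNReal.ofReal_inv_of_pos (by positivity),
      ENNReal.ofReal_mul (by norm_num)]
    simp
  · have : (2:ℝ) ≤ (K:ℝ) * m := by
      have : 2 ≤ K * m := by omega
      exact_mod_cast this
    rw [e]
    generalize (K:ℝ) * m = n at *
    rw [one_div, one_div, ENNReal.ofReal_inv_of_pos (by nlinarith),
      ENNReal.ofReal_mul (by positivity), ENNReal.ofReal_sub _ (by norm_num)]
    simp
  · simp

theorem sum_muR (K m : ℕ) (x : Fin K → Fin m → Bool) (G : (Fin K → Fin m → Bool) → ℝ) :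
    ∑ y, muR K m x y * G y = 1 / (2 * (K * m : ℝ)) * ∑ p, G (fl x p) +
      1 / ((K * m : ℝ) * ((K * m : ℝ) - 1)) * (1 / 2) *
      ∑ r ∈ (Finset.univ : Finset (Fin K × Fin m)).offDiag, G (fl (fl x r.1) r.2) := by
  rw [← sum_h1, ← sum_h2, Finset.mul_sum, Finset.mul_sum, ← Finset.sum_add_distrib]
  refine Finset.sum_congr rfl fun y _ => ?_
  unfold muR
  by_cases h1 : hdist K m x y = 1
  · simp [h1]
  · by_cases h2 : hdist K m x y = 2
    · simp only [h2]; norm_num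
      ring
    · simp [h1, h2]

theorem sum_muR_le (K m : ℕ) (hK : 1 ≤ K) (hm : 1 ≤ m) (x : Fin K → Fin m → Bool) :
    ∑ y, muR K m x y ≤ 1 := by
  have := sum_muR K m x (fun _ => 1)
  simp only [mul_one] at this
  rw [this]
  have h1 : (1:ℝ) ≤ K * m := by exact_mod_cast Nat.mul_pos hK hm
  simp only [Finset.sum_const, Finset.offDiag_card, Finset.card_univ, Fintype.card_prod,
    Fintype.card_fin, nsmul_eq_mul, mul_one]
  have h2 : K * m ≤ K * m * (K * m) := Nat.le_mul_of_pos_right _ (Nat.mul_pos hK hm)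
  push_cast [Nat.cast_sub h2]
  set n : ℝ := (K:ℝ) * m with hn
  have a1 : 1 / (2 * n) * n = 1/2 := by field_simp
  have a2 : 1 / (n * (n-1)) * (1/2) * (n * n - n) ≤ 1/2 := by
    have : n * n - n = n * (n-1) := by ring
    rw [this]
    by_cases h : n = 1
    · rw [h]; norm_num
    · have : n * (n-1) ≠ 0 := by
        apply mul_ne_zero (by linarith)
        intro h'; apply h; linarith
      field_simp; norm_num
  linarith

open scoped Classical in
theorem rls_drift (K m : ℕ) (hK : 1 ≤ K) (hm : 1 ≤ m)
    (acc : (Fin K → Fin m → Bool) → (Fin K → Fin m → Bool) → Prop)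
    (A : (Fin K → Fin m → Bool) → Prop) (Φ : (Fin K → Fin m → Bool) → ℝ) (hΦ : ∀ x, 0 ≤ Φ x)
    (h : ∀ x, ¬ A x → 1 ≤
      1 / (2 * (K * m : ℝ)) * ∑ p, (if acc (fl x p) x then Φ x - Φ (fl x p) else 0) +
      1 / ((K * m : ℝ) * ((K * m : ℝ) - 1)) * (1 / 2) *
      ∑ r ∈ (Finset.univ : Finset (Fin K × Fin m)).offDiag,
        (if acc (fl (fl x r.1) r.2) x then Φ x - Φ (fl (fl x r.1) r.2) else 0))
    (x₀ : Fin K → Fin m → Bool) :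
    expHitTime K m (stepP K m (mutRLS K m) acc) A x₀ ≤ ENNReal.ofReal (Φ x₀) := by
  refine hit_drift K m _ A (fun x => ENNReal.ofReal (Φ x)) ?_ x₀
  intro x hx
  have hd := h x hx
  rw [← sum_muR K m x (fun y => if acc y x then Φ x - Φ y else 0)] at hd
  have hμ := muR_nonneg K m hK hm x
  have e1 : ∑ y, stepP K m (mutRLS K m) acc x y * ENNReal.ofReal (Φ y)
      = ENNReal.ofReal (∑ y, muR K m x y * (if acc y x then Φ y else Φ x)) := by
    unfold stepP
    simp_rw [add_mul, Finset.sum_add_distrib, ite_mul, zero_mul]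
    rw [Finset.sum_ite_eq' Finset.univ x]
    simp only [Finset.mem_univ, if_true]
    rw [Finset.sum_mul, ← Finset.sum_add_distrib, ENNReal.ofReal_sum_of_nonneg]
    · refine Finset.sum_congr rfl fun y _ => ?_
      rw [mutRLS_eq K m hK hm]
      split_ifs <;> simp [ENNReal.ofReal_mul (hμ y)]
    · intro y _
      have := hμ y
      split_ifs
      · exact mul_nonneg this (hΦ y)
      · exact mul_nonneg this (hΦ x)
  rw [e1]
  have e2 : ∑ y, muR K m x y * (if acc y x then Φ y else Φ x) =
      (∑ y, muR K m x y) * Φ x - ∑ y, muR K m x y * (if acc y x then Φ x - Φ y else 0) := by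
    rw [Finset.sum_mul, ← Finset.sum_sub_distrib]
    refine Finset.sum_congr rfl fun y _ => ?_
    split_ifs <;> ring
  have e3 : (∑ y, muR K m x y) * Φ x ≤ Φ x := by
    have := sum_muR_le K m hK hm x
    nlinarith [hΦ x]
  have e4 : 0 ≤ ∑ y, muR K m x y * (if acc y x then Φ y else Φ x) := by
    refine Finset.sum_nonneg fun y _ => mul_nonneg (hμ y) ?_
    split_ifs
    · exact hΦ y
    · exact hΦ x
  calc _ = ENNReal.ofReal (∑ y, muR K m x y * (if acc y x then Φ y else Φ x) + 1) := by
        rw [ENNReal.ofReal_add e4 (by norm_num)]; simp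
    _ ≤ _ := ENNReal.ofReal_le_ofReal (by linarith)

noncomputable def lin {m : ℕ} (f : Fin m → ℝ) (r : Fin m → Bool) : ℝ :=
  ∑ j, if r j then f j else 0

noncomputable def tot {K m : ℕ} (f : Fin m → ℝ) (x : Fin K → Fin m → Bool) : ℝ :=
  ∑ i, lin f (x i)

noncomputable def sg {K m : ℕ} (f : Fin m → ℝ) (x : Fin K → Fin m → Bool)
    (p : Fin K × Fin m) : ℝ := if x p.1 p.2 then - f p.2 else f p.2

theorem lin_fl {K m : ℕ} (f : Fin m → ℝ) (x : Fin K → Fin m → Bool) (p : Fin K × Fin m)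
    (i : Fin K) : lin f (fl x p i) = lin f (x i) + if i = p.1 then sg f x p else 0 := by
  obtain ⟨a, b⟩ := p
  by_cases h : i = a
  · subst h
    simp only [if_true]
    unfold lin
    rw [← sub_eq_iff_eq_add', ← Finset.sum_sub_distrib, Finset.sum_eq_single b]
    · unfold fl sg; cases x i b <;> simp
    · intro j _ hj
      simp [fl, hj]
    · simp
  · simp only [h, if_false, add_zero]
    unfold lin fl
    simp [h]

theorem tot_fl {K m : ℕ} (f : Fin m → ℝ) (x : Fin K → Fin m → Bool) (p : Fin K × Fin m) :
    tot f (fl x p) = tot f x + sg f x p := by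
  unfold tot
  simp [lin_fl, Finset.sum_add_distrib]

theorem fl_ne {K m : ℕ} (x : Fin K → Fin m → Bool) (p q : Fin K × Fin m) (h : p ≠ q) :
    fl x p q.1 q.2 = x q.1 q.2 := by
  unfold fl; simp [h.symm]

theorem sg_fl {K m : ℕ} (f : Fin m → ℝ) (x : Fin K → Fin m → Bool) (p q : Fin K × Fin m)
    (h : p ≠ q) : sg f (fl x p) q = sg f x q := by
  unfold sg; rw [fl_ne x p q h]

theorem sumF_fl {K m : ℕ} (f : Fin m → ℝ) (F : ℝ → ℝ) (x : Fin K → Fin m → Bool)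
    (p : Fin K × Fin m) :
    ∑ i, F (lin f (fl x p i)) = ∑ i, F (lin f (x i)) +
      (F (lin f (x p.1) + sg f x p) - F (lin f (x p.1))) := by
  rw [← sub_eq_iff_eq_add', ← Finset.sum_sub_distrib, Finset.sum_eq_single p.1]
  · simp [lin_fl]
  · intro i _ hi
    simp [lin_fl, hi]
  · simp

theorem lin_add {m : ℕ} (f g : Fin m → ℝ) (r : Fin m → Bool) :
    lin (fun j => f j + g j) r = lin f r + lin g r := by
  unfold lin
  rw [← Finset.sum_add_distrib]
  refine Finset.sum_congr rfl fun j _ => ?_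
  split_ifs <;> simp

theorem tot_add {K m : ℕ} (f g : Fin m → ℝ) (x : Fin K → Fin m → Bool) :
    tot (fun j => f j + g j) x = tot f x + tot g x := by
  unfold tot
  simp [lin_add, Finset.sum_add_distrib]

theorem lin_nonneg {m : ℕ} (f : Fin m → ℝ) (hf : ∀ j, 0 ≤ f j) (r : Fin m → Bool) :
    0 ≤ lin f r := by
  refine Finset.sum_nonneg fun j _ => ?_
  split_ifs
  · exact hf j
  · exact le_rfl

theorem tot_nonneg {K m : ℕ} (f : Fin m → ℝ) (hf : ∀ j, 0 ≤ f j) (x : Fin K → Fin m → Bool) :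
    0 ≤ tot f x := Finset.sum_nonneg fun _ _ => lin_nonneg f hf _

theorem lin_le {m : ℕ} (f : Fin m → ℝ) (hf : ∀ j, 0 ≤ f j) (r : Fin m → Bool) :
    lin f r ≤ ∑ j, f j := by
  refine Finset.sum_le_sum fun j _ => ?_
  split_ifs
  · exact le_rfl
  · exact hf j

theorem tot_le {K m : ℕ} (f : Fin m → ℝ) (hf : ∀ j, 0 ≤ f j) (x : Fin K → Fin m → Bool) :
    tot f x ≤ K * ∑ j, f j := by
  calc tot f x ≤ ∑ _i : Fin K, ∑ j, f j := Finset.sum_le_sum fun i _ => lin_le f hf _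
    _ = _ := by simp

theorem lin_nat {m : ℕ} (f : Fin m → ℝ) (hf : ∀ j, f j = 0 ∨ f j = 1) (r : Fin m → Bool) :
    ∃ n : ℕ, lin f r = n := by
  classical
  refine ⟨∑ j, if r j then (if f j = 1 then 1 else 0) else 0, ?_⟩
  unfold lin
  push_cast
  refine Finset.sum_congr rfl fun j _ => ?_
  rcases hf j with h | h <;> simp [h]

theorem tot_nat {K m : ℕ} (f : Fin m → ℝ) (hf : ∀ j, f j = 0 ∨ f j = 1)
    (x : Fin K → Fin m → Bool) : ∃ n : ℕ, tot f x = n := by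
  choose g hg using fun i => lin_nat f hf (x i)
  refine ⟨∑ i, g i, ?_⟩
  unfold tot; push_cast; simp [hg]

/-- number of ones in a group -/
noncomputable def kk {K m : ℕ} (x : Fin K → Fin m → Bool) (i : Fin K) : ℝ := lin (fun _ => 1) (x i)
noncomputable def NN {K m : ℕ} (x : Fin K → Fin m → Bool) : ℝ := tot (fun _ => 1) x
noncomputable def QQ {K m : ℕ} (x : Fin K → Fin m → Bool) : ℝ :=
  ∑ i, (fun t : ℝ => t ^ 2 - t) (lin (fun _ => 1) (x i))

theorem kk_nat {K m : ℕ} (x : Fin K → Fin m → Bool) (i : Fin K) : ∃ n : ℕ, kk x i = n :=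
  lin_nat _ (by simp) _

theorem QQ_nonneg {K m : ℕ} (x : Fin K → Fin m → Bool) : 0 ≤ QQ x := by
  refine Finset.sum_nonneg fun i _ => ?_
  obtain ⟨n, hn⟩ := kk_nat x i
  unfold kk at hn
  simp only [hn]
  have : n ≤ n ^ 2 := by nlinarith [Nat.zero_le n, Nat.le_mul_self n]
  have : (n:ℝ) ≤ (n:ℝ)^2 := by exact_mod_cast this
  linarith

theorem NN_nonneg {K m : ℕ} (x : Fin K → Fin m → Bool) : 0 ≤ NN x :=
  tot_nonneg _ (by simp) _

theorem NN_eq {K m : ℕ} (x : Fin K → Fin m → Bool) : (numOnes K m x : ℝ) = NN x := by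
  unfold numOnes NN tot lin
  push_cast
  rfl

theorem pair_sum {m : ℕ} (b : Fin m → ℝ) (hb : ∀ j, b j * b j = b j) :
    2 * ∑ p ∈ Finset.univ.filter (fun p : Fin m × Fin m => p.1 < p.2), b p.1 * b p.2
      = (∑ j, b j) ^ 2 - ∑ j, b j := by
  have h1 : (∑ j, b j) ^ 2 = ∑ p : Fin m × Fin m, b p.1 * b p.2 := by
    rw [sq, Finset.sum_mul_sum, ← Finset.univ_product_univ, Finset.sum_product]
  have h2 : ∑ p : Fin m × Fin m, b p.1 * b p.2 =
      ∑ p : Fin m × Fin m, (if p.1 < p.2 then b p.1 * b p.2 else 0) +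
      ∑ p : Fin m × Fin m, (if p.2 < p.1 then b p.1 * b p.2 else 0) +
      ∑ p : Fin m × Fin m, (if p.1 = p.2 then b p.1 * b p.2 else 0) := by
    rw [← Finset.sum_add_distrib, ← Finset.sum_add_distrib]
    refine Finset.sum_congr rfl fun p _ => ?_
    rcases lt_trichotomy p.1 p.2 with h | h | h
    · simp [h, h.ne, h.le, not_lt.mpr h.le]
    · simp [h]
    · simp [h, h.ne', not_lt.mpr h.le]
  have h3 : ∑ p : Fin m × Fin m, (if p.2 < p.1 then b p.1 * b p.2 else 0) =
      ∑ p : Fin m × Fin m, (if p.1 < p.2 then b p.1 * b p.2 else 0) := by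
    refine Finset.sum_equiv (Equiv.prodComm _ _) (by simp) ?_
    intro p _
    simp [mul_comm]
  have h4 : ∑ p : Fin m × Fin m, (if p.1 = p.2 then b p.1 * b p.2 else 0) = ∑ j, b j := by
    rw [← Finset.univ_product_univ, Finset.sum_product]
    refine Finset.sum_congr rfl fun j _ => ?_
    simp [hb]
  rw [Finset.sum_filter, h1, h2, h3, h4]
  ring

theorem var_eq {K m : ℕ} (d c : ℝ) (x : Fin K → Fin m → Bool) :
    varWeight K m d c x = d * NN x + c * QQ x := by
  unfold varWeight cova QQ
  rw [NN_eq]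
  congr 1
  rw [mul_comm 2 c, mul_assoc]
  congr 1
  rw [Finset.mul_sum]
  refine Finset.sum_congr rfl fun i _ => ?_
  have := pair_sum (fun j => if x i j then (1:ℝ) else 0) (by intro j; split_ifs <;> simp)
  rw [this]
  rfl

section acc
variable {K m : ℕ} {a d c B α : ℝ} {prof : Fin m → ℝ}

theorem exp_eq (x : Fin K → Fin m → Bool) : expWeight K m a x = a * NN x := by
  unfold expWeight; rw [NN_eq]

theorem cheb_mono (ha : 0 < a) (hd : 0 < d) (hc : 0 < c) {x y : Fin K → Fin m → Bool}
    (hN : NN y ≤ NN x) (hQ : QQ y ≤ QQ x) (hB : a * NN x < B) :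
    chebBeta K m a d c B y ≤ chebBeta K m a d c B x := by
  unfold chebBeta
  rw [var_eq, var_eq, exp_eq, exp_eq]
  have hy : 0 ≤ d * NN y + c * QQ y := by
    have := NN_nonneg y; have := QQ_nonneg y; positivity
  have hV : d * NN y + c * QQ y ≤ d * NN x + c * QQ x := by gcongr
  have hs : B - a * NN x ≤ B - a * NN y := by
    have : a * NN y ≤ a * NN x := by gcongr
    linarith
  have hs0 : 0 < B - a * NN x := by linarith
  generalize d * NN y + c * QQ y = v at *
  generalize d * NN x + c * QQ x = w at *
  generalize B - a * NN x = s at *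
  generalize B - a * NN y = t at *
  have h2 : s ^ 2 ≤ t ^ 2 := by gcongr
  have h3 : 0 < s ^ 2 := by positivity
  rw [div_le_div_iff₀ (by linarith) (by linarith)]
  nlinarith

theorem cheb_strict (ha : 0 < a) {x y : Fin K → Fin m → Bool} (hd : 0 < d) (hc : 0 < c)
    (hN : NN x ≤ NN y) (hV : d * NN x + c * QQ x < d * NN y + c * QQ y) (hB : a * NN y < B) :
    chebBeta K m a d c B x < chebBeta K m a d c B y := by
  unfold chebBeta
  rw [var_eq, var_eq, exp_eq, exp_eq]
  have hy : 0 ≤ d * NN x + c * QQ x := by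
    have := NN_nonneg x; have := QQ_nonneg x; positivity
  have hs : B - a * NN y ≤ B - a * NN x := by
    have : a * NN x ≤ a * NN y := by gcongr
    linarith
  have hs0 : 0 < B - a * NN y := by linarith
  generalize d * NN y + c * QQ y = v at *
  generalize d * NN x + c * QQ x = w at *
  generalize B - a * NN x = s at *
  generalize B - a * NN y = t at *
  have h2 : t ^ 2 ≤ s ^ 2 := by gcongr
  have h3 : 0 < t ^ 2 := by positivity
  rw [div_lt_div_iff₀ (by linarith) (by linarith)]
  nlinarith

theorem cheb_lt_one (hd : 0 < d) (hc : 0 < c) {x : Fin K → Fin m → Bool} (hB : a * NN x < B) :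
    chebBeta K m a d c B x < 1 := by
  unfold chebBeta
  rw [var_eq, exp_eq]
  have hy : 0 ≤ d * NN x + c * QQ x := by
    have := NN_nonneg x; have := QQ_nonneg x; positivity
  have : 0 < (B - a * NN x) ^ 2 := by have : 0 < B - a * NN x := by linarith
                                      positivity
  rw [div_lt_one (by linarith)]
  linarith

theorem feas_iff (h1 : α < 1) (x : Fin K → Fin m → Bool) :
    feasible K m a d c B α x ↔ ¬ α < betaPrime K m a d c B x := by
  unfold feasible betaPrime
  split_ifs with h
  · simp [h]
  · simp only [h, false_and, false_iff, not_not]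
    linarith [not_lt.mp h]

theorem pP_feas (h1 : α < 1) {x : Fin K → Fin m → Bool} (hx : feasible K m a d c B α x) :
    pPrime K m a d c B α (fun _ j => prof j) x = tot prof x := by
  rw [feas_iff h1] at hx
  unfold pPrime
  rw [if_neg hx]; rfl

theorem pP_infeas (h1 : α < 1) {x : Fin K → Fin m → Bool} (hx : ¬ feasible K m a d c B α x) :
    pPrime K m a d c B α (fun _ j => prof j) x = -1 := by
  rw [feas_iff h1, not_not] at hx
  unfold pPrime
  rw [if_pos hx]

theorem bP_feas {x : Fin K → Fin m → Bool} (hx : feasible K m a d c B α x) :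
    betaPrime K m a d c B x = chebBeta K m a d c B x := by
  unfold betaPrime; rw [if_pos hx.1]

theorem feas_mono (ha : 0 < a) (hd : 0 < d) (hc : 0 < c)
    {x y : Fin K → Fin m → Bool} (hx : feasible K m a d c B α x)
    (hN : NN y ≤ NN x) (hQ : QQ y ≤ QQ x) : feasible K m a d c B α y := by
  have hB := hx.1
  rw [exp_eq] at hB
  refine ⟨?_, le_trans (cheb_mono ha hd hc hN hQ hB) hx.2⟩
  rw [exp_eq]
  have : a * NN y ≤ a * NN x := by gcongr
  linarith

theorem acc_of_le (h1 : α < 1) (ha : 0 < a) (hd : 0 < d) (hc : 0 < c)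
    {x y : Fin K → Fin m → Bool} (hx : feasible K m a d c B α x)
    (hN : NN y ≤ NN x) (hQ : QQ y ≤ QQ x) (hp : tot prof x ≤ tot prof y) :
    fge K m a d c B α (fun _ j => prof j) y x := by
  have hy := feas_mono ha hd hc hx hN hQ
  unfold fge
  rw [pP_feas h1 hx, pP_feas h1 hy, bP_feas hx, bP_feas hy]
  rcases hp.lt_or_eq with h | h
  · exact Or.inl h
  · refine Or.inr ⟨h.symm, cheb_mono ha hd hc hN hQ ?_⟩
    have := hx.1
    rwa [exp_eq] at this

theorem acc_of_feas (h1 : α < 1)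
    {x y : Fin K → Fin m → Bool} (hx : feasible K m a d c B α x)
    (hy : feasible K m a d c B α y) (hp : tot prof x < tot prof y) :
    fge K m a d c B α (fun _ j => prof j) y x := by
  unfold fge
  rw [pP_feas h1 hx, pP_feas h1 hy]
  exact Or.inl hp

theorem of_acc (h1 : α < 1) (ha : 0 < a) (hd : 0 < d) (hc : 0 < c) (hprof : ∀ j, 0 ≤ prof j)
    {x y : Fin K → Fin m → Bool} (hx : feasible K m a d c B α x)
    (h : fge K m a d c B α (fun _ j => prof j) y x) :
    feasible K m a d c B α y ∧ tot prof x ≤ tot prof y ∧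
    (tot prof y = tot prof x → NN x ≤ NN y →
      d * NN y + c * QQ y ≤ d * NN x + c * QQ x) := by
  have hp0 := tot_nonneg prof hprof x
  have hy : feasible K m a d c B α y := by
    by_contra hy
    unfold fge at h
    rw [pP_feas h1 hx, pP_infeas h1 hy] at h
    rcases h with h | ⟨h, _⟩ <;> linarith
  unfold fge at h
  rw [pP_feas h1 hx, pP_feas h1 hy, bP_feas hx, bP_feas hy] at h
  refine ⟨hy, ?_, ?_⟩
  · rcases h with h | ⟨h, _⟩ <;> linarith
  · intro he hN
    by_contra hV
    rw [not_le] at hV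
    rcases h with h | ⟨_, h⟩
    · linarith
    · have hB := hy.1
      rw [exp_eq] at hB
      exact absurd h (not_le.mpr (cheb_strict ha hd hc hN hV hB))

theorem inf_acc (h1 : α < 1) (ha : 0 < a) (hd : 0 < d) (hc : 0 < c) (hprof : ∀ j, 0 ≤ prof j)
    {x y : Fin K → Fin m → Bool} (hx : ¬ feasible K m a d c B α x)
    (hN : NN y ≤ NN x) (hQ : QQ y ≤ QQ x) :
    fge K m a d c B α (fun _ j => prof j) y x := by
  have hp0 := tot_nonneg prof hprof y
  unfold fge
  rw [pP_infeas h1 hx]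
  by_cases hy : feasible K m a d c B α y
  · rw [pP_feas h1 hy]; left; linarith
  · rw [pP_infeas h1 hy]
    right
    refine ⟨rfl, ?_⟩
    unfold betaPrime
    rw [exp_eq, exp_eq]
    have hle : a * NN y ≤ a * NN x := by gcongr
    split_ifs with h2 h3 h3
    · exact cheb_mono ha hd hc hN hQ h3
    · have := cheb_lt_one (a := a) hd hc h2
      linarith
    · linarith
    · linarith

theorem inf_of_acc (h1 : α < 1) (ha : 0 < a) (hd : 0 < d) (hc : 0 < c)
    {x y : Fin K → Fin m → Bool} (hx : ¬ feasible K m a d c B α x)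
    (hy : ¬ feasible K m a d c B α y)
    (h : fge K m a d c B α (fun _ j => prof j) y x) :
    ¬ (NN x < NN y ∧ QQ x ≤ QQ y) := by
  rintro ⟨hN, hQ⟩
  unfold fge at h
  rw [pP_infeas h1 hx, pP_infeas h1 hy] at h
  have hlt : a * NN x < a * NN y := by gcongr
  have hV : d * NN x + c * QQ x < d * NN y + c * QQ y := by
    have : d * NN x < d * NN y := by gcongr
    have : c * QQ x ≤ c * QQ y := by gcongr
    linarith
  rcases h with h | ⟨_, h⟩
  · linarith
  · unfold betaPrime at h
    rw [exp_eq, exp_eq] at h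
    split_ifs at h with h2 h3 h3
    · exact absurd h (not_le.mpr (cheb_strict ha hd hc hN.le hV h2))
    · linarith
    · have := cheb_lt_one (a := a) hd hc h3
      linarith
    · linarith

end acc

noncomputable def ga {m : ℕ} (prof : Fin m → ℝ) (τ : ℝ) (j : Fin m) : ℝ := if τ < prof j then 1 else 0
noncomputable def mi {m : ℕ} (prof : Fin m → ℝ) (τ : ℝ) (j : Fin m) : ℝ := if prof j = τ then 1 else 0
noncomputable def ov {m : ℕ} (prof : Fin m → ℝ) (τ : ℝ) (j : Fin m) : ℝ := if prof j < τ then 1 else 0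
noncomputable def op {m : ℕ} (prof : Fin m → ℝ) (τ : ℝ) (j : Fin m) : ℝ :=
  if 0 < prof j ∧ prof j < τ then 1 else 0
noncomputable def ge {m : ℕ} (prof : Fin m → ℝ) (τ : ℝ) (j : Fin m) : ℝ := if τ ≤ prof j then 1 else 0
noncomputable def ze {m : ℕ} (prof : Fin m → ℝ) (j : Fin m) : ℝ := if prof j ≤ 0 then 1 else 0
noncomputable def po {m : ℕ} (prof : Fin m → ℝ) (j : Fin m) : ℝ := if 0 < prof j then 1 else 0
noncomputable def hh (K : ℕ) (e : ℝ) : ℝ := K * e / (e + K)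
noncomputable def FF (t : ℝ) : ℝ := t * (t - 1) / 2

noncomputable def UU {K m : ℕ} (prof : Fin m → ℝ) (τ : ℝ) (x : Fin K → Fin m → Bool) : ℝ :=
  K * ∑ j, ga prof τ j - tot (ga prof τ) x
noncomputable def OO {K m : ℕ} (prof : Fin m → ℝ) (τ : ℝ) (x : Fin K → Fin m → Bool) : ℝ :=
  tot (op prof τ) x
noncomputable def ZZ {K m : ℕ} (prof : Fin m → ℝ) (x : Fin K → Fin m → Bool) : ℝ :=
  tot (ze prof) x
noncomputable def gg {K m : ℕ} (prof : Fin m → ℝ) (τ : ℝ) (x : Fin K → Fin m → Bool) : ℝ :=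
  (∑ i, FF (lin (mi prof τ) (x i))) / ∑ j, mi prof τ j
noncomputable def XX {K m : ℕ} (prof : Fin m → ℝ) (τ : ℝ) (x : Fin K → Fin m → Bool) : ℝ :=
  gg prof τ x + 2 * UU prof τ x + 2 * OO prof τ x + 2 * ZZ prof x
noncomputable def WW {K m : ℕ} (prof : Fin m → ℝ) (τ : ℝ) (x : Fin K → Fin m → Bool) : ℝ :=
  8 * hh K (UU prof τ x) + 8 * hh K (OO prof τ x) +
    min (XX prof τ x) (K * ∑ j, mi prof τ j) + 2 * ZZ prof x
noncomputable def tau {K m : ℕ} (prof : Fin m → ℝ) (x : Fin K → Fin m → Bool) : ℝ :=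
  if h : ⌊tot (po prof) x / K⌋₊ < m then prof ⟨_, h⟩ else 0
noncomputable def TT {K m : ℕ} (prof : Fin m → ℝ) (x : Fin K → Fin m → Bool) : ℝ :=
  80 * (K * m - tot (po prof) x) + WW prof (tau prof x) x
    + 17 * K * (m - ∑ j, ge prof (tau prof x) j)

section pot
variable {K m : ℕ} {prof : Fin m → ℝ} {τ : ℝ}

theorem ga01 (j : Fin m) : ga prof τ j = 0 ∨ ga prof τ j = 1 := by unfold ga; split_ifs <;> simp
theorem mi01 (j : Fin m) : mi prof τ j = 0 ∨ mi prof τ j = 1 := by unfold mi; split_ifs <;> simp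
theorem ov01 (j : Fin m) : ov prof τ j = 0 ∨ ov prof τ j = 1 := by unfold ov; split_ifs <;> simp
theorem op01 (j : Fin m) : op prof τ j = 0 ∨ op prof τ j = 1 := by unfold op; split_ifs <;> simp
theorem ge01 (j : Fin m) : ge prof τ j = 0 ∨ ge prof τ j = 1 := by unfold ge; split_ifs <;> simp
theorem ze01 (j : Fin m) : ze prof j = 0 ∨ ze prof j = 1 := by unfold ze; split_ifs <;> simp
theorem po01 (j : Fin m) : po prof j = 0 ∨ po prof j = 1 := by unfold po; split_ifs <;> simp

theorem nn01 {f : Fin m → ℝ} (hf : ∀ j, f j = 0 ∨ f j = 1) (j : Fin m) : 0 ≤ f j := by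
  rcases hf j with h | h <;> simp [h]
theorem le01 {f : Fin m → ℝ} (hf : ∀ j, f j = 0 ∨ f j = 1) (j : Fin m) : f j ≤ 1 := by
  rcases hf j with h | h <;> simp [h]

theorem sum_le_m {f : Fin m → ℝ} (hf : ∀ j, f j = 0 ∨ f j = 1) : ∑ j, f j ≤ m := by
  calc ∑ j, f j ≤ ∑ _j : Fin m, (1:ℝ) := Finset.sum_le_sum fun j _ => le01 hf j
    _ = m := by simp

theorem sg_le {f : Fin m → ℝ} (hf : ∀ j, f j = 0 ∨ f j = 1) (x : Fin K → Fin m → Bool)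
    (p : Fin K × Fin m) : sg f x p ≤ 1 := by
  unfold sg; split_ifs <;> rcases hf p.2 with h | h <;> rw [h] <;> norm_num
theorem sg_ge {f : Fin m → ℝ} (hf : ∀ j, f j = 0 ∨ f j = 1) (x : Fin K → Fin m → Bool)
    (p : Fin K × Fin m) : -1 ≤ sg f x p := by
  unfold sg; split_ifs <;> rcases hf p.2 with h | h <;> rw [h] <;> norm_num

theorem hh_nonneg {e : ℝ} (he : 0 ≤ e) : 0 ≤ hh K e := by unfold hh; positivity
theorem hh_le {e : ℝ} (hK : 1 ≤ K) (he : 0 ≤ e) : hh K e ≤ K := by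
  have : (1:ℝ) ≤ K := by exact_mod_cast hK
  unfold hh
  rw [div_le_iff₀ (by linarith)]
  nlinarith
theorem hh_mono {e f : ℝ} (hK : 1 ≤ K) (he : 0 ≤ e) (hef : e ≤ f) : hh K e ≤ hh K f := by
  have : (1:ℝ) ≤ K := by exact_mod_cast hK
  unfold hh
  rw [div_le_div_iff₀ (by linarith) (by linarith)]
  have : (K:ℝ) * K * e ≤ K * K * f := by gcongr
  nlinarith
theorem hh_succ {e : ℝ} (hK : 1 ≤ K) (he : 0 ≤ e) : hh K (e + 1) ≤ hh K e + 1 := by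
  have : (1:ℝ) ≤ K := by exact_mod_cast hK
  unfold hh
  rw [div_add_one (by linarith), div_le_div_iff₀ (by linarith) (by linarith)]
  nlinarith [mul_nonneg he he, mul_nonneg he (by linarith : (0:ℝ) ≤ K)]
theorem hh_lip {e f : ℝ} (hK : 1 ≤ K) (he : 0 ≤ e) (hf : 0 ≤ f) (h : f ≤ e + 1) :
    hh K f ≤ hh K e + 1 := le_trans (hh_mono hK hf h) (hh_succ hK he)

theorem UU_nonneg (x : Fin K → Fin m → Bool) : 0 ≤ UU prof τ x := by
  have := tot_le (ga prof τ) (nn01 ga01) x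
  unfold UU; linarith
theorem OO_nonneg (x : Fin K → Fin m → Bool) : 0 ≤ OO prof τ x := tot_nonneg _ (nn01 op01) x
theorem ZZ_nonneg (x : Fin K → Fin m → Bool) : 0 ≤ ZZ prof x := tot_nonneg _ (nn01 ze01) x
theorem w_nonneg : 0 ≤ ∑ j, mi prof τ j := Finset.sum_nonneg fun j _ => nn01 mi01 j

theorem gg_nonneg (x : Fin K → Fin m → Bool) : 0 ≤ gg prof τ x := by
  unfold gg
  refine div_nonneg (Finset.sum_nonneg fun i _ => ?_) w_nonneg
  obtain ⟨n, hn⟩ := lin_nat (mi prof τ) mi01 (x i)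
  rw [hn]; unfold FF
  rcases Nat.eq_zero_or_pos n with h | h
  · subst h; simp
  · have : (1:ℝ) ≤ n := by exact_mod_cast h
    have : 0 ≤ (n:ℝ) - 1 := by linarith
    positivity

theorem XX_nonneg (x : Fin K → Fin m → Bool) : 0 ≤ XX prof τ x := by
  have := gg_nonneg (prof := prof) (τ := τ) x
  have := UU_nonneg (prof := prof) (τ := τ) x
  have := OO_nonneg (prof := prof) (τ := τ) x
  have := ZZ_nonneg (prof := prof) x
  unfold XX; linarith

theorem WW_nonneg (x : Fin K → Fin m → Bool) : 0 ≤ WW prof τ x := by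
  have h1 := hh_nonneg (K := K) (UU_nonneg (prof := prof) (τ := τ) x)
  have h2 := hh_nonneg (K := K) (OO_nonneg (prof := prof) (τ := τ) x)
  have h3 := ZZ_nonneg (prof := prof) x
  have h4 : 0 ≤ min (XX prof τ x) (K * ∑ j, mi prof τ j) :=
    le_min (XX_nonneg x) (mul_nonneg (by positivity) w_nonneg)
  unfold WW; linarith

theorem WW_le (hK : 1 ≤ K) (x : Fin K → Fin m → Bool) :
    WW prof τ x ≤ 16 * K + K * ∑ j, mi prof τ j + 2 * ZZ prof x := by
  have h1 := hh_le hK (UU_nonneg (prof := prof) (τ := τ) x)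
  have h2 := hh_le hK (OO_nonneg (prof := prof) (τ := τ) x)
  have h4 := min_le_right (XX prof τ x) (K * ∑ j, mi prof τ j)
  unfold WW; linarith

theorem gg_fl (hw : 1 ≤ ∑ j, mi prof τ j) (x : Fin K → Fin m → Bool) (p : Fin K × Fin m) :
    gg prof τ (fl x p) ≤ gg prof τ x + 1 := by
  unfold gg
  rw [sumF_fl (mi prof τ) FF, div_add_one (by linarith)]
  gcongr
  have h0 := lin_nonneg _ (nn01 (mi01 (prof := prof) (τ := τ))) (x p.1)
  have h1 := lin_le _ (nn01 (mi01 (prof := prof) (τ := τ))) (x p.1)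
  unfold FF sg
  split_ifs <;> rcases mi01 (prof := prof) (τ := τ) p.2 with h | h <;> rw [h] <;> nlinarith

theorem WW_fl (hK : 1 ≤ K) (hw : 1 ≤ ∑ j, mi prof τ j) (x : Fin K → Fin m → Bool)
    (p : Fin K × Fin m) : WW prof τ (fl x p) ≤ WW prof τ x + 25 := by
  have hU : UU prof τ (fl x p) ≤ UU prof τ x + 1 := by
    unfold UU; rw [tot_fl]; linarith [sg_ge (ga01 (prof := prof) (τ := τ)) x p]
  have hO : OO prof τ (fl x p) ≤ OO prof τ x + 1 := by
    unfold OO; rw [tot_fl]; linarith [sg_le (op01 (prof := prof) (τ := τ)) x p]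
  have hZ : ZZ prof (fl x p) ≤ ZZ prof x + 1 := by
    unfold ZZ; rw [tot_fl]; linarith [sg_le (ze01 (prof := prof)) x p]
  have hg := gg_fl hw x p
  have hX : XX prof τ (fl x p) ≤ XX prof τ x + 7 := by unfold XX; linarith
  have h1 := hh_lip hK (UU_nonneg x) (UU_nonneg _) hU
  have h2 := hh_lip hK (OO_nonneg x) (OO_nonneg _) hO
  have h3 : min (XX prof τ (fl x p)) (K * ∑ j, mi prof τ j) ≤
      min (XX prof τ x) (K * ∑ j, mi prof τ j) + 7 := by
    rw [← min_add_add_right]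
    exact min_le_min hX (by linarith)
  unfold WW; linarith

theorem cnt_lt (q : ℕ) : ∑ j : Fin m, (if (j:ℕ) < q then (1:ℝ) else 0) ≤ q := by
  rw [Fin.sum_univ_eq_sum_range (fun j => if j < q then (1:ℝ) else 0) m, Finset.sum_ite]
  simp only [Finset.sum_const_zero, add_zero, Finset.sum_const, nsmul_eq_mul, mul_one]
  have : ((Finset.range m).filter fun j => j < q).card ≤ q := by
    calc _ ≤ (Finset.range q).card := Finset.card_le_card (by intro j; simp)
      _ = q := by simp
  exact_mod_cast this

theorem cnt_le (q : ℕ) (hq : q < m) : (q:ℝ) + 1 ≤ ∑ j : Fin m, (if (j:ℕ) ≤ q then (1:ℝ) else 0) := by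
  rw [Fin.sum_univ_eq_sum_range (fun j => if j ≤ q then (1:ℝ) else 0) m, Finset.sum_ite]
  simp only [Finset.sum_const_zero, add_zero, Finset.sum_const, nsmul_eq_mul, mul_one]
  have : q + 1 ≤ ((Finset.range m).filter fun j => j ≤ q).card := by
    calc q + 1 = (Finset.range (q+1)).card := by simp
      _ ≤ _ := Finset.card_le_card (by intro j; simp; omega)
  exact_mod_cast this

/-- basic facts on the active class when some positive item is missing -/
theorem tau_facts (hK : 1 ≤ K) (hmono : ∀ j j' : Fin m, j ≤ j' → prof j' ≤ prof j)
    (x : Fin K → Fin m → Bool) (hmiss : ∃ p : Fin K × Fin m, x p.1 p.2 = false ∧ 0 < prof p.2) :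
    0 < tau prof x ∧ K * ∑ j, ga prof (tau prof x) j ≤ tot (po prof) x ∧
    tot (po prof) x < K * ∑ j, ge prof (tau prof x) j ∧ 1 ≤ ∑ j, mi prof (tau prof x) j ∧
    tot (po prof) x + 1 ≤ K * m := by
  obtain ⟨p, hp1, hp2⟩ := hmiss
  have hKr : (1:ℝ) ≤ K := by exact_mod_cast hK
  have h1 : tot (po prof) x + 1 ≤ K * ∑ j, po prof j := by
    have := tot_le (po prof) (nn01 po01) (fl x p)
    rw [tot_fl] at this
    simpa [sg, hp1, po, hp2] using this
  have hm' : tot (po prof) x + 1 ≤ K * m := by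
    have := sum_le_m (po01 (prof := prof))
    have : (K:ℝ) * ∑ j, po prof j ≤ K * m := by gcongr
    linarith
  have h0 : 0 ≤ tot (po prof) x := tot_nonneg _ (nn01 po01) x
  set q := ⌊tot (po prof) x / K⌋₊ with hq
  have hq1 : K * (q:ℝ) ≤ tot (po prof) x := by
    have := Nat.floor_le (show 0 ≤ tot (po prof) x / K by positivity)
    rw [← hq, le_div_iff₀ (by linarith)] at this
    linarith
  have hq2 : tot (po prof) x < K * ((q:ℝ) + 1) := by
    have := Nat.lt_floor_add_one (tot (po prof) x / K)
    rw [← hq, div_lt_iff₀ (by linarith)] at this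
    linarith
  have hpos : ∃ h : q < m, 0 < prof ⟨q, h⟩ := by
    by_contra hcon
    push Not at hcon
    have : ∑ j, po prof j ≤ q := by
      refine le_trans (Finset.sum_le_sum fun j _ => ?_) (cnt_lt (m := m) q)
      unfold po
      split_ifs with a b
      · exact le_rfl
      · exfalso
        have hlt : q < m := by omega
        have := hcon hlt
        have := hmono ⟨q, hlt⟩ j (by rw [Fin.le_def]; simp; omega)
        linarith
      · norm_num
      · norm_num
    have : (K:ℝ) * ∑ j, po prof j ≤ K * q := by gcongr
    linarith
  obtain ⟨hqm, hpq⟩ := hpos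
  have ht : tau prof x = prof ⟨q, hqm⟩ := by
    unfold tau
    rw [dif_pos hqm]
  refine ⟨by rw [ht]; exact hpq, ?_, ?_, ?_, hm'⟩
  · have : ∑ j, ga prof (tau prof x) j ≤ q := by
      refine le_trans (Finset.sum_le_sum fun j _ => ?_) (cnt_lt (m := m) q)
      unfold ga
      rw [ht]
      split_ifs with a b
      · exact le_rfl
      · exfalso
        have := hmono ⟨q, hqm⟩ j (by rw [Fin.le_def]; simp; omega)
        linarith
      · norm_num
      · norm_num
    have : (K:ℝ) * ∑ j, ga prof (tau prof x) j ≤ K * q := by gcongr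
    linarith
  · have : (q:ℝ) + 1 ≤ ∑ j, ge prof (tau prof x) j := by
      refine le_trans (cnt_le q hqm) (Finset.sum_le_sum fun j _ => ?_)
      unfold ge
      rw [ht]
      split_ifs with a b
      · exact le_rfl
      · exfalso
        have := hmono j ⟨q, hqm⟩ (by rw [Fin.le_def]; exact a)
        linarith
      · norm_num
      · norm_num
    have : K * ((q:ℝ) + 1) ≤ K * ∑ j, ge prof (tau prof x) j := by gcongr
    linarith
  · have : mi prof (tau prof x) ⟨q, hqm⟩ = 1 := by unfold mi; simp [ht]
    rw [← this]
    exact Finset.single_le_sum (f := mi prof (tau prof x)) (fun j _ => nn01 mi01 j) (Finset.mem_univ _)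

theorem ge_split : ∑ j, ge prof τ j = ∑ j, ga prof τ j + ∑ j, mi prof τ j := by
  rw [← Finset.sum_add_distrib]
  refine Finset.sum_congr rfl fun j _ => ?_
  unfold ge ga mi
  rcases lt_trichotomy (prof j) τ with h | h | h
  · simp [not_le.mpr h, not_lt.mpr h.le, h.ne]
  · simp [h]
  · simp [h, h.le, h.ne']

/-- drop when the number of positive items increases -/
theorem drop_up (hK : 1 ≤ K) (hmono : ∀ j j' : Fin m, j ≤ j' → prof j' ≤ prof j)
    (x y : Fin K → Fin m → Bool) (hx : ∃ p : Fin K × Fin m, x p.1 p.2 = false ∧ 0 < prof p.2)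
    (hy : ∃ p : Fin K × Fin m, y p.1 p.2 = false ∧ 0 < prof p.2)
    (hW : ∀ τ, 1 ≤ ∑ j, mi prof τ j → WW prof τ y ≤ WW prof τ x + 50)
    (hZ : ZZ prof y ≤ ZZ prof x + 2) (hp : tot (po prof) x + 1 ≤ tot (po prof) y) :
    TT prof y + 20 ≤ TT prof x := by
  obtain ⟨x1, x2, x3, x4, x5⟩ := tau_facts hK hmono x hx
  obtain ⟨y1, y2, y3, y4, y5⟩ := tau_facts hK hmono y hy
  have hKr : (1:ℝ) ≤ K := by exact_mod_cast hK
  unfold TT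
  rcases lt_trichotomy (tau prof x) (tau prof y) with h | h | h
  · exfalso
    have : ∑ j, ge prof (tau prof y) j ≤ ∑ j, ga prof (tau prof x) j := by
      refine Finset.sum_le_sum fun j _ => ?_
      unfold ge ga
      split_ifs with a b
      · exact le_rfl
      · exfalso; linarith
      · norm_num
      · norm_num
    have : (K:ℝ) * ∑ j, ge prof (tau prof y) j ≤ K * ∑ j, ga prof (tau prof x) j := by gcongr
    linarith
  · have := hW _ x4
    rw [← h]
    linarith
  · have h1 : ∑ j, ge prof (tau prof x) j + ∑ j, mi prof (tau prof y) j ≤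
        ∑ j, ge prof (tau prof y) j := by
      rw [← Finset.sum_add_distrib]
      refine Finset.sum_le_sum fun j _ => ?_
      unfold ge mi
      split_ifs <;> first | linarith | norm_num
    have h2 := WW_le (prof := prof) (τ := tau prof y) hK y
    have h3 : (K:ℝ) * (∑ j, ge prof (tau prof x) j + ∑ j, mi prof (tau prof y) j) ≤
        K * ∑ j, ge prof (tau prof y) j := by gcongr
    have h4 : (K:ℝ) * 1 ≤ K * ∑ j, mi prof (tau prof y) j := by gcongr
    have h5 : 2 * ZZ prof x ≤ WW prof (tau prof x) x := by
      have h1 := hh_nonneg (K := K) (UU_nonneg (prof := prof) (τ := tau prof x) x)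
      have h2 := hh_nonneg (K := K) (OO_nonneg (prof := prof) (τ := tau prof x) x)
      have h4 : 0 ≤ min (XX prof (tau prof x) x) (K * ∑ j, mi prof (tau prof x) j) :=
        le_min (XX_nonneg x) (mul_nonneg (by positivity) w_nonneg)
      unfold WW; linarith
    linarith

theorem TT_ge (x : Fin K → Fin m → Bool) (h : tot (po prof) x + 1 ≤ K * m) :
    80 ≤ TT prof x := by
  have h1 := WW_nonneg (prof := prof) (τ := tau prof x) x
  have h2 := sum_le_m (ge01 (prof := prof) (τ := tau prof x))
  have h3 : 0 ≤ 17 * (K:ℝ) * (m - ∑ j, ge prof (tau prof x) j) :=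
    mul_nonneg (by positivity) (by linarith)
  unfold TT; linarith

theorem TT_le (hK : 1 ≤ K) (hm : 1 ≤ m) (x : Fin K → Fin m → Bool) :
    TT prof x ≤ 116 * (K * m) := by
  have hKr : (1:ℝ) ≤ K := by exact_mod_cast hK
  have hmr : (1:ℝ) ≤ m := by exact_mod_cast hm
  have h1 := WW_le (prof := prof) (τ := tau prof x) hK x
  have h2 : 0 ≤ ∑ j, ge prof (tau prof x) j := Finset.sum_nonneg fun j _ => nn01 ge01 j
  have h3 := sum_le_m (mi01 (prof := prof) (τ := tau prof x))
  have h4 : ZZ prof x ≤ K * m := by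
    refine le_trans (tot_le (ze prof) (nn01 ze01) x) ?_
    have := sum_le_m (ze01 (prof := prof))
    gcongr
  have h5 : 0 ≤ tot (po prof) x := tot_nonneg _ (nn01 po01) x
  have h6 : (K:ℝ) * ∑ j, mi prof (tau prof x) j ≤ K * m := by gcongr
  have h7 : (K:ℝ) * 1 ≤ K * m := by gcongr
  have h8 : 0 ≤ (K:ℝ) * ∑ j, ge prof (tau prof x) j := by positivity
  unfold TT; nlinarith

end pot

structure Hyp (K m : ℕ) (a d c B α : ℝ) (prof : Fin m → ℝ) : Prop where
  hK : 1 ≤ K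
  hm : 1 ≤ m
  ha : 0 < a
  hd : 0 < d
  hc : 0 < c
  hB : 0 < B
  h0 : 0 < α
  h1 : α < 1
  hprof : ∀ j, 0 ≤ prof j
  hmono : ∀ j j' : Fin m, j ≤ j' → prof j' ≤ prof j

def opt {K m : ℕ} (a d c B α : ℝ) (prof : Fin m → ℝ) (x : Fin K → Fin m → Bool) : Prop :=
  feasible K m a d c B α x ∧ ∀ z, feasible K m a d c B α z → tot prof z ≤ tot prof x

open scoped Classical in
noncomputable def Tp {K m : ℕ} (a d c B α : ℝ) (prof : Fin m → ℝ) (x : Fin K → Fin m → Bool) : ℝ :=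
  if opt a d c B α prof x then 0 else TT prof x

noncomputable def th {K m : ℕ} (prof : Fin m → ℝ) (τ : ℝ) (x : Fin K → Fin m → Bool) : ℝ :=
  if XX prof τ x ≤ K * ∑ j, mi prof τ j then 1 else 0

section moves
variable {K m : ℕ} {a d c B α : ℝ} {prof : Fin m → ℝ}

theorem miss_of (H : Hyp K m a d c B α prof) {x : Fin K → Fin m → Bool}
    (hx : feasible K m a d c B α x) (hn : ¬ opt a d c B α prof x) :
    ∃ p : Fin K × Fin m, x p.1 p.2 = false ∧ 0 < prof p.2 := by
  by_contra hcon
  push Not at hcon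
  apply hn
  refine ⟨hx, fun z _ => ?_⟩
  unfold tot lin
  refine Finset.sum_le_sum fun i _ => Finset.sum_le_sum fun j _ => ?_
  have h1 := H.hprof j
  have h2 := hcon (i, j)
  simp only at h2
  cases hxx : x i j
  · have := h2 hxx
    simp only [Bool.false_eq_true, if_false]
    split_ifs <;> linarith
  · simp only [if_true]
    split_ifs <;> linarith

theorem tau_congr {x y : Fin K → Fin m → Bool} (h : tot (po prof) y = tot (po prof) x) :
    tau prof y = tau prof x := by
  unfold tau; simp only [h]

theorem TT_ge80 (H : Hyp K m a d c B α prof) {x : Fin K → Fin m → Bool}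
    (hx : feasible K m a d c B α x) (hn : ¬ opt a d c B α prof x) : 80 ≤ TT prof x :=
  TT_ge x (tau_facts H.hK H.hmono x (miss_of H hx hn)).2.2.2.2

theorem drop_one (H : Hyp K m a d c B α prof) {x : Fin K → Fin m → Bool} (p : Fin K × Fin m)
    (hx : feasible K m a d c B α x) (hn : ¬ opt a d c B α prof x)
    (hy : feasible K m a d c B α (fl x p))
    (hp : tot (po prof) x + 1 ≤ tot (po prof) (fl x p)) :
    20 ≤ TT prof x - Tp a d c B α prof (fl x p) := by
  have h80 := TT_ge80 H hx hn
  unfold Tp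
  split_ifs with ho
  · linarith
  · have := drop_up H.hK H.hmono x (fl x p) (miss_of H hx hn) (miss_of H hy ho)
      (fun τ hτ => by linarith [WW_fl H.hK hτ x p])
      (by unfold ZZ; rw [tot_fl]; linarith [sg_le (ze01 (prof := prof)) x p]) hp
    linarith

theorem drop_two (H : Hyp K m a d c B α prof) {x : Fin K → Fin m → Bool} (p q : Fin K × Fin m)
    (hx : feasible K m a d c B α x) (hn : ¬ opt a d c B α prof x)
    (hy : feasible K m a d c B α (fl (fl x p) q))
    (hp : tot (po prof) x + 1 ≤ tot (po prof) (fl (fl x p) q)) :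
    20 ≤ TT prof x - Tp a d c B α prof (fl (fl x p) q) := by
  have h80 := TT_ge80 H hx hn
  unfold Tp
  split_ifs with ho
  · linarith
  · have := drop_up H.hK H.hmono x (fl (fl x p) q) (miss_of H hx hn) (miss_of H hy ho)
      (fun τ hτ => by linarith [WW_fl H.hK hτ x p, WW_fl H.hK hτ (fl x p) q])
      (by unfold ZZ; rw [tot_fl, tot_fl]; linarith [sg_le (ze01 (prof := prof)) x p,
            sg_le (ze01 (prof := prof)) (fl x p) q]) hp
    linarith

theorem drop_same (H : Hyp K m a d c B α prof) {x y : Fin K → Fin m → Bool}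
    (hx : feasible K m a d c B α x) (hn : ¬ opt a d c B α prof x)
    (hp : tot (po prof) y = tot (po prof) x) :
    80 ≤ TT prof x - Tp a d c B α prof y ∨
    TT prof x - Tp a d c B α prof y = WW prof (tau prof x) x - WW prof (tau prof x) y := by
  have h80 := TT_ge80 H hx hn
  unfold Tp
  split_ifs with ho
  · left; linarith
  · right
    unfold TT
    rw [tau_congr hp, hp]
    ring

theorem WW_drop (τ : ℝ) (x y : Fin K → Fin m → Bool) :
    8 * (hh K (UU prof τ x) - hh K (UU prof τ y)) + 8 * (hh K (OO prof τ x) - hh K (OO prof τ y))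
    + 2 * (ZZ prof x - ZZ prof y) + th prof τ x * (XX prof τ x - XX prof τ y)
    ≤ WW prof τ x - WW prof τ y := by
  unfold WW th
  split_ifs with h
  · rw [min_eq_left h]
    linarith [min_le_left (XX prof τ y) (K * ∑ j, mi prof τ j)]
  · rw [min_eq_right (not_le.mp h).le]
    linarith [min_le_right (XX prof τ y) (K * ∑ j, mi prof τ j)]

theorem gg_fl0 (τ : ℝ) (x : Fin K → Fin m → Bool) (p : Fin K × Fin m) (h : mi prof τ p.2 = 0) :
    gg prof τ (fl x p) = gg prof τ x := by
  unfold gg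
  rw [sumF_fl (mi prof τ) FF]
  simp [sg, h]

theorem th01 (τ : ℝ) (x : Fin K → Fin m → Bool) : th prof τ x = 0 ∨ th prof τ x = 1 := by
  unfold th; split_ifs <;> simp

theorem sg_t (f : Fin m → ℝ) (x : Fin K → Fin m → Bool) (p : Fin K × Fin m)
    (h : x p.1 p.2 = true) : sg f x p = - f p.2 := by unfold sg; simp [h]
theorem sg_f (f : Fin m → ℝ) (x : Fin K → Fin m → Bool) (p : Fin K × Fin m)
    (h : x p.1 p.2 = false) : sg f x p = f p.2 := by unfold sg; simp [h]

theorem QQ_fl (x : Fin K → Fin m → Bool) (p : Fin K × Fin m) :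
    QQ (fl x p) = QQ x + if x p.1 p.2 then - (2 * kk x p.1 - 2) else 2 * kk x p.1 := by
  unfold QQ
  rw [sumF_fl (fun _ => (1:ℝ)) (fun t : ℝ => t^2 - t)]
  unfold kk sg
  split_ifs <;> ring

theorem kk_fl (x : Fin K → Fin m → Bool) (p : Fin K × Fin m) (i : Fin K) :
    kk (fl x p) i = kk x i + if i = p.1 then (if x p.1 p.2 then -1 else 1) else 0 := by
  unfold kk; rw [lin_fl]; rfl

theorem NN_fl (x : Fin K → Fin m → Bool) (p : Fin K × Fin m) :
    NN (fl x p) = NN x + if x p.1 p.2 then -1 else 1 := by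
  unfold NN; rw [tot_fl]; rfl

theorem QQ_swap (x : Fin K → Fin m → Bool) (s t : Fin K × Fin m)
    (hs : x s.1 s.2 = true) (ht : x t.1 t.2 = false) :
    QQ (fl (fl x s) t) = QQ x + if t.1 = s.1 then 0 else 2 * (kk x t.1 - kk x s.1 + 1) := by
  have hst : s ≠ t := by rintro rfl; rw [hs] at ht; cases ht
  rw [QQ_fl, QQ_fl, fl_ne x s t hst, kk_fl]
  simp only [hs, ht, if_true, Bool.false_eq_true, if_false]
  split_ifs with h
  · rw [h]; ring
  · ring

theorem gg_swap (τ : ℝ) (x : Fin K → Fin m → Bool) (s t : Fin K × Fin m)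
    (hs : x s.1 s.2 = true) (ht : x t.1 t.2 = false) (ms : mi prof τ s.2 = 1)
    (mt : mi prof τ t.2 = 1) :
    gg prof τ (fl (fl x s) t) = gg prof τ x + if t.1 = s.1 then 0 else
      (lin (mi prof τ) (x t.1) - lin (mi prof τ) (x s.1) + 1) / ∑ j, mi prof τ j := by
  have hst : s ≠ t := by rintro rfl; rw [hs] at ht; cases ht
  unfold gg
  rw [sumF_fl (mi prof τ) FF, sumF_fl (mi prof τ) FF, sg_fl _ _ _ _ hst, lin_fl, sg_t _ _ _ hs,
    sg_f _ _ _ ht, ms, mt]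
  unfold FF
  split_ifs with h
  · rw [h]; ring
  · ring

theorem tot_swap (f : Fin m → ℝ) (x : Fin K → Fin m → Bool) (s t : Fin K × Fin m)
    (hs : x s.1 s.2 = true) (ht : x t.1 t.2 = false) :
    tot f (fl (fl x s) t) = tot f x - f s.2 + f t.2 := by
  have hst : s ≠ t := by rintro rfl; rw [hs] at ht; cases ht
  rw [tot_fl, tot_fl, sg_fl _ _ _ _ hst, sg_t _ _ _ hs, sg_f _ _ _ ht]
  ring

theorem NN_swap (x : Fin K → Fin m → Bool) (s t : Fin K × Fin m)
    (hs : x s.1 s.2 = true) (ht : x t.1 t.2 = false) :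
    NN (fl (fl x s) t) = NN x := by
  unfold NN; rw [tot_swap _ _ _ _ hs ht]; ring

theorem ga_of_eq {τ : ℝ} {j : Fin m} (h : prof j = τ) : ga prof τ j = 0 := by simp [ga, h]
end moves

open scoped Classical in
noncomputable def okr {K m : ℕ} (x : Fin K → Fin m → Bool) (i' i : Fin K) : ℝ :=
  if i' = i ∨ kk x i + 1 ≤ kk x i' then 1 else 0
open scoped Classical in
noncomputable def okq {K m : ℕ} (x : Fin K → Fin m → Bool) (i' i : Fin K) : ℝ :=
  if kk x i + 1 ≤ kk x i' then 1 else 0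
open scoped Classical in
noncomputable def dd (K : ℕ) (e : ℝ) : ℝ := if 1 ≤ e then hh K e - hh K (e - 1) else 0
open scoped Classical in
noncomputable def DD {K m : ℕ} (a d c B α : ℝ) (prof : Fin m → ℝ) (x y : Fin K → Fin m → Bool) : ℝ :=
  if fge K m a d c B α (fun _ j => prof j) y x then TT prof x - Tp a d c B α prof y else 0

noncomputable def AA {K m : ℕ} (prof : Fin m → ℝ) (τ : ℝ) (x : Fin K → Fin m → Bool)
    (j' j : Fin m) : ℝ :=
  th prof τ x * (ov prof τ j' * mi prof τ j) + th prof τ x * (mi prof τ j' * ga prof τ j)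
  + 8 * dd K (OO prof τ x) * (ov prof τ j' * (mi prof τ j + ga prof τ j))
  + 8 * dd K (UU prof τ x) * ((mi prof τ j' + ov prof τ j') * ga prof τ j)

section swap
variable {K m : ℕ} {a d c B α : ℝ} {prof : Fin m → ℝ}

theorem dd_nonneg (hK : 1 ≤ K) (e : ℝ) : 0 ≤ dd K e := by
  unfold dd; split_ifs with h
  · linarith [hh_mono (K := K) hK (show 0 ≤ e - 1 by linarith) (show e - 1 ≤ e by linarith)]
  · exact le_rfl
theorem dd_le (hK : 1 ≤ K) (e : ℝ) : dd K e ≤ 1 := by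
  unfold dd; split_ifs with h
  · have := hh_succ (K := K) hK (show 0 ≤ e - 1 by linarith)
    rw [sub_add_cancel] at this
    linarith
  · norm_num

theorem cls (τ : ℝ) (j : Fin m) :
    (τ < prof j ∧ ga prof τ j = 1 ∧ mi prof τ j = 0 ∧ ov prof τ j = 0) ∨
    (prof j = τ ∧ ga prof τ j = 0 ∧ mi prof τ j = 1 ∧ ov prof τ j = 0) ∨
    (prof j < τ ∧ ga prof τ j = 0 ∧ mi prof τ j = 0 ∧ ov prof τ j = 1) := by
  rcases lt_trichotomy (prof j) τ with h | h | h
  · right; right; simp [ga, mi, ov, h, h.ne, h.le]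
  · right; left; simp [ga, mi, ov, h]
  · left; simp [ga, mi, ov, h, h.ne', h.le]

theorem op_eq (τ : ℝ) (j : Fin m) : op prof τ j = po prof j * ov prof τ j := by
  unfold op po ov; split_ifs <;> simp_all
theorem ze_eq (j : Fin m) : ze prof j = 1 - po prof j := by
  unfold ze po; split_ifs <;> first | linarith | norm_num
theorem po_pos {j : Fin m} (h : 0 < prof j) : po prof j = 1 := by simp [po, h]

theorem swap_lb (H : Hyp K m a d c B α prof) {x : Fin K → Fin m → Bool}
    (hx : feasible K m a d c B α x) (hn : ¬ opt a d c B α prof x) (s t : Fin K × Fin m)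
    (hs : x s.1 s.2 = true) (ht : x t.1 t.2 = false) {τ : ℝ} (hτ : τ = tau prof x) :
    okr x s.1 t.1 * AA prof τ x s.2 t.2 + okq x s.1 t.1 * (th prof τ x *
      (mi prof τ s.2 * mi prof τ t.2 * ((lin (mi prof τ) (x s.1) - lin (mi prof τ) (x t.1) - 1)
        / ∑ j, mi prof τ j))) ≤ DD a d c B α prof x (fl (fl x s) t) := by
  obtain ⟨f1, f2, f3, f4, f5⟩ := tau_facts H.hK H.hmono x (miss_of H hx hn)
  rw [← hτ] at f1 f2 f3 f4
  set y := fl (fl x s) t with hy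
  have hNN : NN y = NN x := NN_swap x s t hs ht
  have hQQ := QQ_swap x s t hs ht
  rw [← hy] at hQQ
  have hpr : tot prof y = tot prof x - prof s.2 + prof t.2 := tot_swap _ x s t hs ht
  have hpo : tot (po prof) y = tot (po prof) x - po prof s.2 + po prof t.2 :=
    tot_swap _ x s t hs ht
  have hUU : UU prof τ y = UU prof τ x + ga prof τ s.2 - ga prof τ t.2 := by
    unfold UU; rw [tot_swap _ x s t hs ht]; ring
  have hOO : OO prof τ y = OO prof τ x - op prof τ s.2 + op prof τ t.2 := tot_swap _ x s t hs ht
  have hZZ : ZZ prof y = ZZ prof x - ze prof s.2 + ze prof t.2 := tot_swap _ x s t hs ht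
  have hUy := UU_nonneg (prof := prof) (τ := τ) y
  have hOy := OO_nonneg (prof := prof) (τ := τ) y
  have dO0 := dd_nonneg H.hK (OO prof τ x)
  have dO1 := dd_le H.hK (OO prof τ x)
  have dU0 := dd_nonneg H.hK (UU prof τ x)
  have dU1 := dd_le H.hK (UU prof τ x)
  have hth0 : 0 ≤ th prof τ x := by rcases th01 (prof := prof) τ x with h | h <;> rw [h] <;> norm_num
  have hth1 : th prof τ x ≤ 1 := by rcases th01 (prof := prof) τ x with h | h <;> rw [h] <;> norm_num
  have hWW := WW_drop (prof := prof) τ x y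
  have hokr : okr x s.1 t.1 = 0 ∨ okr x s.1 t.1 = 1 := by unfold okr; split_ifs <;> simp
  have hokq : okq x s.1 t.1 = 0 ∨ okq x s.1 t.1 = 1 := by unfold okq; split_ifs <;> simp
  -- acceptance
  have hacc : okr x s.1 t.1 = 1 → prof s.2 ≤ prof t.2 →
      fge K m a d c B α (fun _ j => prof j) y x := by
    intro h1 h2
    refine acc_of_le H.h1 H.ha H.hd H.hc hx hNN.le ?_ (by linarith)
    rw [hQQ]
    unfold okr at h1
    split_ifs with h3
    · linarith
    · split_ifs at h1 with h4
      · rcases h4 with h4 | h4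
        · exact absurd h4.symm h3
        · linarith
      · norm_num at h1
  -- okr and okq for middle moves
  have hqr : okq x s.1 t.1 = 1 → okr x s.1 t.1 = 1 := by
    unfold okq okr
    intro h; split_ifs at h with h2
    · simp [h2]
    · norm_num at h
  by_cases hA : fge K m a d c B α (fun _ j => prof j) y x
  swap
  · have hD : DD a d c B α prof x y = 0 := by unfold DD; rw [if_neg hA]
    rw [hD]
    by_cases hle : prof s.2 ≤ prof t.2
    · have h1 : okr x s.1 t.1 = 0 := by
        rcases hokr with h | h
        · exact h
        · exact absurd (hacc h hle) hA
      have h2 : okq x s.1 t.1 = 0 := by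
        rcases hokq with h | h
        · exact h
        · rw [hqr h] at h1; norm_num at h1
      rw [h1, h2]; simp
    · have hlt := not_le.mp hle
      have e : AA prof τ x s.2 t.2 = 0 ∧ mi prof τ s.2 * mi prof τ t.2 = 0 := by
        unfold AA
        rcases cls (prof := prof) τ s.2 with ⟨h0, h1, h2, h3⟩ | ⟨h0, h1, h2, h3⟩ | ⟨h0, h1, h2, h3⟩ <;>
        rcases cls (prof := prof) τ t.2 with ⟨g0, g1, g2, g3⟩ | ⟨g0, g1, g2, g3⟩ | ⟨g0, g1, g2, g3⟩ <;>
        rw [h2, h3, g1, g2] <;> first | (exfalso; linarith) | simp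
      rw [e.1, e.2]; simp
  · have hD : DD a d c B α prof x y = TT prof x - Tp a d c B α prof y := by
      unfold DD; rw [if_pos hA]
    rw [hD]
    obtain ⟨yf, hple, hvar⟩ := of_acc H.h1 H.ha H.hd H.hc H.hprof hx hA
    have hle : prof s.2 ≤ prof t.2 := by linarith
    set E := TT prof x - Tp a d c B α prof y with hE
    have c0 : 0 ≤ lin (mi prof τ) (x t.1) := lin_nonneg _ (nn01 mi01) _
    have c1 : lin (mi prof τ) (x s.1) ≤ ∑ j, mi prof τ j := lin_le _ (nn01 mi01) _
    have hR20 : 20 ≤ E → okr x s.1 t.1 * AA prof τ x s.2 t.2 + okq x s.1 t.1 * (th prof τ x *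
      (mi prof τ s.2 * mi prof τ t.2 * ((lin (mi prof τ) (x s.1) - lin (mi prof τ) (x t.1) - 1)
        / ∑ j, mi prof τ j))) ≤ E := by
      intro h20
      have hq : (lin (mi prof τ) (x s.1) - lin (mi prof τ) (x t.1) - 1) / ∑ j, mi prof τ j ≤ 1 := by
        rw [div_le_one (by linarith)]; linarith
      have h1 : okr x s.1 t.1 * AA prof τ x s.2 t.2 ≤ 18 := by
        have : AA prof τ x s.2 t.2 ≤ 18 ∧ 0 ≤ AA prof τ x s.2 t.2 := by
          unfold AA
          rcases cls (prof := prof) τ s.2 with ⟨h0, h1, h2, h3⟩ | ⟨h0, h1, h2, h3⟩ | ⟨h0, h1, h2, h3⟩ <;>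
          rcases cls (prof := prof) τ t.2 with ⟨g0, g1, g2, g3⟩ | ⟨g0, g1, g2, g3⟩ | ⟨g0, g1, g2, g3⟩ <;>
          rw [h2, h3, g1, g2] <;> constructor <;> linarith
        rcases hokr with h | h <;> rw [h] <;> linarith
      have h2 : ∀ u v w z q : ℝ, (u = 0 ∨ u = 1) → (v = 0 ∨ v = 1) → (w = 0 ∨ w = 1) →
          (z = 0 ∨ z = 1) → q ≤ 1 → u * (v * (w * z * q)) ≤ 1 := by
        rintro u v w z q (rfl | rfl) (rfl | rfl) (rfl | rfl) (rfl | rfl) hq <;> norm_num <;> exact hq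
      have h3 := h2 _ _ _ _ _ hokq (th01 (prof := prof) τ x) (mi01 (prof := prof) (τ := τ) s.2)
        (mi01 (prof := prof) (τ := τ) t.2) hq
      linarith
    by_cases hlt : po prof s.2 < po prof t.2
    · apply hR20
      refine drop_two H s t hx hn yf ?_
      rw [hpo]
      rcases po01 (prof := prof) s.2 with h | h <;> rcases po01 (prof := prof) t.2 with h' | h' <;>
        rw [h, h'] at hlt ⊢ <;> first | linarith | (norm_num at hlt)
    · have hpe : po prof s.2 = po prof t.2 := by
        unfold po at hlt ⊢
        split_ifs at hlt ⊢ <;> first | rfl | (exfalso; linarith) | (norm_num at hlt)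
      have hZ' : ZZ prof y = ZZ prof x := by rw [hZZ, ze_eq, ze_eq, hpe]; ring
      rcases drop_same (y := y) H hx hn (by rw [hpo, hpe]; ring) with h80 | hW
      · exact hR20 (by linarith)
      rw [← hE, ← hτ] at hW
      rw [hW]
      refine le_trans ?_ hWW
      have hXe : XX prof τ x - XX prof τ y = gg prof τ x - gg prof τ y +
        2 * (UU prof τ x - UU prof τ y) + 2 * (OO prof τ x - OO prof τ y) := by
        unfold XX; rw [hZ']; ring
      rw [hXe, hZ', sub_self, mul_zero, add_zero]
      rw [op_eq, op_eq] at hOO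
      rcases cls (prof := prof) τ s.2 with ⟨h0, h1, h2, h3⟩ | ⟨h0, h1, h2, h3⟩ | ⟨h0, h1, h2, h3⟩ <;>
      rcases cls (prof := prof) τ t.2 with ⟨g0, g1, g2, g3⟩ | ⟨g0, g1, g2, g3⟩ | ⟨g0, g1, g2, g3⟩ <;>
      (try (exfalso; linarith)) <;> unfold AA <;>
      rw [h1, g1] at hUU <;> rw [h3, g3] at hOO <;> rw [h2, h3, g1, g2]
      · -- ga ga
        have e1 : gg prof τ y = gg prof τ x := by rw [hy, gg_fl0 _ _ _ g2, gg_fl0 _ _ _ h2]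
        have e2 : UU prof τ y = UU prof τ x := by linarith
        have e3 : OO prof τ y = OO prof τ x := by linarith
        rw [e1, e2, e3]; simp
      · -- mi ga
        have e1 : gg prof τ y ≤ gg prof τ x + 1 := by
          rw [hy, gg_fl0 _ _ _ g2]; exact gg_fl f4 x s
        have e2 : UU prof τ y = UU prof τ x - 1 := by linarith
        have e3 : OO prof τ y = OO prof τ x := by linarith
        have e4 : dd K (UU prof τ x) = hh K (UU prof τ x) - hh K (UU prof τ x - 1) := by
          unfold dd; rw [if_pos (by linarith)]
        rw [e2, e3, ← e4]
        have : th prof τ x * 1 ≤ th prof τ x * (gg prof τ x - gg prof τ y +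
          2 * (UU prof τ x - (UU prof τ x - 1)) + 2 * (OO prof τ x - OO prof τ x)) :=
            mul_le_mul_of_nonneg_left (by linarith) hth0
        rcases hokr with h | h <;> rw [h] <;> linarith
      · -- mi mi
        have e1 := gg_swap (prof := prof) τ x s t hs ht h2 g2
        rw [← hy] at e1
        have e2 : UU prof τ y = UU prof τ x := by linarith
        have e3 : OO prof τ y = OO prof τ x := by linarith
        rw [e1, e2, e3]
        have hv := hvar (by rw [hpr, h0, g0]; ring) hNN.ge
        rw [hNN] at hv
        have hv' : QQ y ≤ QQ x := by
          by_contra hcon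
          have := mul_lt_mul_of_pos_left (not_le.mp hcon) H.hc
          linarith
        rw [hQQ] at hv'
        split_ifs at hv' ⊢ with hg
        · have : okq x s.1 t.1 = 0 := by
            unfold okq; rw [hg, if_neg (by linarith)]
          rw [this]; simp
        · have : okq x s.1 t.1 = 1 := by
            unfold okq; rw [if_pos (by linarith)]
          rw [this]
          apply le_of_eq; ring
      · -- ov ga
        have e1 : gg prof τ y = gg prof τ x := by rw [hy, gg_fl0 _ _ _ g2, gg_fl0 _ _ _ h2]
        have e5 : po prof s.2 = 1 := by rw [hpe]; exact po_pos (by linarith)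
        rw [e5] at hOO
        have e2 : UU prof τ y = UU prof τ x - 1 := by linarith
        have e3 : OO prof τ y = OO prof τ x - 1 := by linarith
        have e4 : dd K (UU prof τ x) = hh K (UU prof τ x) - hh K (UU prof τ x - 1) := by
          unfold dd; rw [if_pos (by linarith)]
        have e6 : dd K (OO prof τ x) = hh K (OO prof τ x) - hh K (OO prof τ x - 1) := by
          unfold dd; rw [if_pos (by linarith)]
        rw [e1, e2, e3, ← e4, ← e6]
        rcases hokr with h | h <;> rw [h] <;> linarith
      · -- ov mi
        have e1 : gg prof τ y ≤ gg prof τ x + 1 := by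
          rw [hy, ← gg_fl0 (prof := prof) τ x s h2]; exact gg_fl f4 _ t
        have e5 : po prof s.2 = 1 := by rw [hpe]; exact po_pos (by linarith)
        rw [e5] at hOO
        have e2 : UU prof τ y = UU prof τ x := by linarith
        have e3 : OO prof τ y = OO prof τ x - 1 := by linarith
        have e6 : dd K (OO prof τ x) = hh K (OO prof τ x) - hh K (OO prof τ x - 1) := by
          unfold dd; rw [if_pos (by linarith)]
        rw [e2, e3, ← e6]
        have : th prof τ x * 1 ≤ th prof τ x * (gg prof τ x - gg prof τ y +
          2 * (UU prof τ x - UU prof τ x) + 2 * (OO prof τ x - (OO prof τ x - 1))) :=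
            mul_le_mul_of_nonneg_left (by linarith) hth0
        rcases hokr with h | h <;> rw [h] <;> linarith
      · -- ov ov
        have e1 : gg prof τ y = gg prof τ x := by rw [hy, gg_fl0 _ _ _ g2, gg_fl0 _ _ _ h2]
        have e2 : UU prof τ y = UU prof τ x := by linarith
        have e3 : OO prof τ y = OO prof τ x := by rw [hOO, hpe]; ring
        rw [e1, e2, e3]; simp
end swap

section count
variable {K m : ℕ}

theorem count_lemma (hK : 1 ≤ K) (o u k : Fin K → ℝ) (r e : ℝ)
    (ho : ∀ i, ∃ n : ℕ, o i = n) (hu : ∀ i, ∃ n : ℕ, u i = n) (hk : ∀ i, ∃ n : ℕ, k i = n)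
    (hkr : ∀ i, k i = r - u i + o i) (he : 1 ≤ e) (hoe : e ≤ ∑ i, o i) (hue : e ≤ ∑ i, u i)
    (G : Fin K → Fin K → ℝ) (hG1 : ∀ i' i, (i' = i ∨ k i + 1 ≤ k i') → G i' i = 1)
    (hG0 : ∀ i' i, ¬ (i' = i ∨ k i + 1 ≤ k i') → G i' i = 0) :
    1 ≤ 8 * dd K e * ∑ i', ∑ i, G i' i * (o i' * u i) := by
  have hKr : (1:ℝ) ≤ K := by exact_mod_cast hK
  have ho0 : ∀ i, 0 ≤ o i := fun i => by obtain ⟨n, h⟩ := ho i; rw [h]; positivity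
  have hu0 : ∀ i, 0 ≤ u i := fun i => by obtain ⟨n, h⟩ := hu i; rw [h]; positivity
  have hG : ∀ i' i, G i' i = 0 ∨ G i' i = 1 := fun i' i => by
    by_cases h : i' = i ∨ k i + 1 ≤ k i'
    · right; exact hG1 _ _ h
    · left; exact hG0 _ _ h
  have hT0 : ∀ i' i, 0 ≤ G i' i * (o i' * u i) := fun i' i => by
    have := mul_nonneg (ho0 i') (hu0 i)
    rcases hG i' i with h | h <;> rw [h] <;> linarith
  set N := ∑ i', ∑ i, G i' i * (o i' * u i) with hN
  have hdiag : ∑ i, o i * u i ≤ N := by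
    rw [hN]
    refine Finset.sum_le_sum fun i _ => ?_
    have := Finset.single_le_sum (f := fun l => G i l * (o i * u l)) (fun l _ => hT0 i l)
      (Finset.mem_univ i)
    simpa [hG1 i i (Or.inl rfl)] using this
  have hpair : ∀ i' i, o i' * u i ≤ G i' i * (o i' * u i) + (o i * u i + o i' * u i') := by
    intro i' i
    have a1 := mul_nonneg (ho0 i) (hu0 i)
    have a2 := mul_nonneg (ho0 i') (hu0 i')
    by_cases h : i' = i ∨ k i + 1 ≤ k i'
    · rw [hG1 _ _ h]; linarith
    · rw [hG0 _ _ h]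
      push Not at h
      have h2 := h.2
      have h3 : k i' ≤ k i := by
        obtain ⟨n1, e1⟩ := hk i
        obtain ⟨n2, e2⟩ := hk i'
        rw [e1, e2] at h2 ⊢
        have : n2 < n1 + 1 := by exact_mod_cast h2
        exact_mod_cast Nat.lt_succ_iff.mp this
      rw [hkr, hkr i] at h3
      rcases le_total (o i') (o i) with b | b
      · have := mul_le_mul_of_nonneg_right b (hu0 i); linarith
      · have := mul_le_mul_of_nonneg_left (show u i ≤ u i' by linarith) (ho0 i'); linarith
  have hsum : (∑ i, o i) * (∑ i, u i) ≤ 3 * K * N := by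
    rw [Finset.sum_mul_sum]
    calc ∑ i', ∑ i, o i' * u i
        ≤ ∑ i', ∑ i, (G i' i * (o i' * u i) + (o i * u i + o i' * u i')) :=
          Finset.sum_le_sum fun i' _ => Finset.sum_le_sum fun i _ => hpair i' i
      _ = N + 2 * K * ∑ i, o i * u i := by
          simp only [Finset.sum_add_distrib, Finset.sum_const, Finset.card_univ, Fintype.card_fin,
            nsmul_eq_mul]
          have : ∑ i, (K:ℝ) * (o i * u i) = K * ∑ i, o i * u i := by rw [Finset.mul_sum]
          rw [hN, this]; ring
      _ ≤ 3 * K * N := by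
          have hN0 : 0 ≤ N := Finset.sum_nonneg fun i' _ => Finset.sum_nonneg fun i _ => hT0 i' i
          have h1 : 2 * K * ∑ i, o i * u i ≤ 2 * K * N := by gcongr
          have h2 : 1 * N ≤ K * N := by gcongr
          linarith
  have hee : e * e ≤ 3 * K * N :=
    le_trans (mul_le_mul hoe hue (by linarith) (by linarith)) hsum
  have hNnat : ∃ n : ℕ, N = n := by
    choose o' ho' using ho
    choose u' hu' using hu
    classical
    refine ⟨∑ i', ∑ i, (if i' = i ∨ k i + 1 ≤ k i' then 1 else 0) * (o' i' * u' i), ?_⟩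
    rw [hN]; push_cast
    refine Finset.sum_congr rfl fun i' _ => Finset.sum_congr rfl fun i _ => ?_
    rw [ho', hu']
    split_ifs with h
    · rw [hG1 _ _ h]
    · rw [hG0 _ _ h]
  have hN1 : 1 ≤ N := by
    obtain ⟨n, hn⟩ := hNnat
    rcases Nat.eq_zero_or_pos n with h | h
    · rw [hn, h] at hee; simp at hee; nlinarith
    · rw [hn]; exact_mod_cast h
  have hdd : dd K e = K^2 / ((e + K) * (e - 1 + K)) := by
    unfold dd hh
    rw [if_pos he, div_sub_div _ _ (by linarith) (by linarith)]
    congr 1; ring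
  rw [hdd, mul_comm (8:ℝ), mul_assoc, div_mul_eq_mul_div, le_div_iff₀ (by apply mul_pos <;> linarith)]
  have h1 : (K:ℝ) * N ≤ K * K * N := by
    have : (K:ℝ) * N * 1 ≤ K * N * K := by gcongr
    linarith
  have h2 : (K:ℝ) * K * 1 ≤ K * K * N := by gcongr
  nlinarith [sq_nonneg (e - K)]

end count

section sums
variable {K m : ℕ} {a d c B α : ℝ} {prof : Fin m → ℝ}

theorem lin_add_mis (f : Fin m → ℝ) (r : Fin m → Bool) :
    ∑ j, f j - lin f r = ∑ j, if r j = false then f j else 0 := by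
  unfold lin
  rw [← Finset.sum_sub_distrib]
  refine Finset.sum_congr rfl fun j _ => ?_
  cases r j <;> simp

theorem sum_prod (x : Fin K → Fin m → Bool) (G : Fin K → Fin K → ℝ) (φ ψ : Fin m → ℝ) :
    ∑ s : Fin K × Fin m, ∑ t : Fin K × Fin m,
      (if x s.1 s.2 = true ∧ x t.1 t.2 = false then G s.1 t.1 * (φ s.2 * ψ t.2) else 0) =
    ∑ i', ∑ i, G i' i * (lin φ (x i') * (∑ j, ψ j - lin ψ (x i))) := by
  simp only [Fintype.sum_prod_type]
  refine Finset.sum_congr rfl fun i' _ => ?_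
  rw [Finset.sum_comm]
  refine Finset.sum_congr rfl fun i _ => ?_
  rw [lin_add_mis]
  unfold lin
  rw [Finset.sum_mul_sum, Finset.mul_sum]
  refine Finset.sum_congr rfl fun j' _ => ?_
  rw [Finset.mul_sum]
  refine Finset.sum_congr rfl fun j _ => ?_
  cases x i' j' <;> cases x i j <;> simp

theorem fl_comm (x : Fin K → Fin m → Bool) (p q : Fin K × Fin m) :
    fl (fl x p) q = fl (fl x q) p := by
  funext i j
  unfold fl
  split_ifs <;> rfl

open scoped Classical in
noncomputable def SS (a d c B α : ℝ) (prof : Fin m → ℝ) (x : Fin K → Fin m → Bool) : ℝ :=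
  ∑ s : Fin K × Fin m, ∑ t : Fin K × Fin m,
      if x s.1 s.2 = true ∧ x t.1 t.2 = false then DD a d c B α prof x (fl (fl x s) t) else 0

theorem one_up (H : Hyp K m a d c B α prof) {x : Fin K → Fin m → Bool}
    (hx : feasible K m a d c B α x) (p : Fin K × Fin m)
    (hp : x p.1 p.2 = false) (hA : fge K m a d c B α (fun _ j => prof j) (fl x p) x) :
    0 < prof p.2 := by
  by_contra hcon
  have h0 : prof p.2 = 0 := le_antisymm (not_lt.mp hcon) (H.hprof _)
  obtain ⟨_, _, h3⟩ := of_acc H.h1 H.ha H.hd H.hc H.hprof hx hA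
  have hN := NN_fl x p
  have hQ := QQ_fl x p
  have hk : 0 ≤ kk x p.1 := by obtain ⟨n, h⟩ := kk_nat x p.1; rw [h]; positivity
  simp only [hp, Bool.false_eq_true, if_false] at hN hQ
  have := h3 (by rw [tot_fl, sg_f _ _ _ hp, h0, add_zero]) (by linarith)
  rw [hN, hQ] at this
  have h4 := H.hd
  have h5 := mul_nonneg H.hc.le hk
  nlinarith

theorem one_nn (H : Hyp K m a d c B α prof) {x : Fin K → Fin m → Bool}
    (hx : feasible K m a d c B α x) (hn : ¬ opt a d c B α prof x) (p : Fin K × Fin m) :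
    0 ≤ DD a d c B α prof x (fl x p) := by
  unfold DD
  split_ifs with hA
  swap
  · exact le_rfl
  obtain ⟨yf, hpl, h3⟩ := of_acc H.h1 H.ha H.hd H.hc H.hprof hx hA
  cases hp : x p.1 p.2
  · have := one_up H hx p hp hA
    have := drop_one H p hx hn yf (by rw [tot_fl, sg_f _ _ _ hp, po_pos this])
    linarith
  · rw [tot_fl, sg_t _ _ _ hp] at hpl
    have h0 : prof p.2 = 0 := le_antisymm (by linarith) (H.hprof _)
    have f1 := (tau_facts H.hK H.hmono x (miss_of H hx hn)).1
    have hpo : po prof p.2 = 0 := by simp [po, h0]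
    rcases drop_same (y := fl x p) H hx hn (by rw [tot_fl, sg_t _ _ _ hp, hpo]; simp) with h | h
    · linarith
    · rw [h]
      refine le_trans ?_ (WW_drop (prof := prof) _ x _)
      have eU : UU prof (tau prof x) (fl x p) = UU prof (tau prof x) x := by
        unfold UU; rw [tot_fl, sg_t _ _ _ hp]; simp [ga, h0, f1.le]
      have eO : OO prof (tau prof x) (fl x p) = OO prof (tau prof x) x := by
        unfold OO; rw [tot_fl, sg_t _ _ _ hp]; simp [op, h0]
      have eZ : ZZ prof (fl x p) = ZZ prof x - 1 := by
        unfold ZZ; rw [tot_fl, sg_t _ _ _ hp]; simp [ze, h0]; ring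
      have eg : gg prof (tau prof x) (fl x p) = gg prof (tau prof x) x :=
        gg_fl0 _ _ _ (by simp [mi, h0, f1.ne])
      unfold XX
      rw [eU, eO, eZ, eg]
      rcases th01 (prof := prof) (tau prof x) x with h | h <;> rw [h] <;> linarith

theorem one_zero (H : Hyp K m a d c B α prof) {x : Fin K → Fin m → Bool}
    (hx : feasible K m a d c B α x) (hn : ¬ opt a d c B α prof x) (p : Fin K × Fin m)
    (hp : x p.1 p.2 = true) (h0 : prof p.2 = 0) :
    2 ≤ DD a d c B α prof x (fl x p) := by
  have f1 := (tau_facts H.hK H.hmono x (miss_of H hx hn)).1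
  have hpo : po prof p.2 = 0 := by simp [po, h0]
  have hk : 1 ≤ kk x p.1 := by
    have h := kk_fl x p p.1
    obtain ⟨n, hn'⟩ := kk_nat (fl x p) p.1
    rw [hn'] at h
    simp only [hp, if_true] at h
    have : (0:ℝ) ≤ n := by positivity
    linarith
  have hA : fge K m a d c B α (fun _ j => prof j) (fl x p) x := by
    refine acc_of_le H.h1 H.ha H.hd H.hc hx ?_ ?_ ?_
    · rw [NN_fl]; simp [hp]
    · rw [QQ_fl]; simp only [hp, if_true]; linarith
    · rw [tot_fl, sg_t _ _ _ hp, h0]; simp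
  unfold DD
  rw [if_pos hA]
  rcases drop_same (y := fl x p) H hx hn (by rw [tot_fl, sg_t _ _ _ hp, hpo]; simp) with h | h
  · linarith
  · rw [h]
    refine le_trans ?_ (WW_drop (prof := prof) _ x _)
    have eU : UU prof (tau prof x) (fl x p) = UU prof (tau prof x) x := by
      unfold UU; rw [tot_fl, sg_t _ _ _ hp]; simp [ga, h0, f1.le]
    have eO : OO prof (tau prof x) (fl x p) = OO prof (tau prof x) x := by
      unfold OO; rw [tot_fl, sg_t _ _ _ hp]; simp [op, h0]
    have eZ : ZZ prof (fl x p) = ZZ prof x - 1 := by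
      unfold ZZ; rw [tot_fl, sg_t _ _ _ hp]; simp [ze, h0]; ring
    have eg : gg prof (tau prof x) (fl x p) = gg prof (tau prof x) x :=
      gg_fl0 _ _ _ (by simp [mi, h0, f1.ne])
    unfold XX
    rw [eU, eO, eZ, eg]
    rcases th01 (prof := prof) (tau prof x) x with h | h <;> rw [h] <;> linarith

theorem two_up (H : Hyp K m a d c B α prof) {x : Fin K → Fin m → Bool}
    (hx : feasible K m a d c B α x) (hn : ¬ opt a d c B α prof x) (p q : Fin K × Fin m)
    (hpq : p ≠ q) (hp : x p.1 p.2 = false) (hq : x q.1 q.2 = false) :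
    0 ≤ DD a d c B α prof x (fl (fl x p) q) := by
  unfold DD
  split_ifs with hA
  swap
  · exact le_rfl
  have hq' : fl x p q.1 q.2 = false := by rw [fl_ne x p q hpq, hq]
  obtain ⟨yf, hpl, h3⟩ := of_acc H.h1 H.ha H.hd H.hc H.hprof hx hA
  have hpo : tot (po prof) (fl (fl x p) q) = tot (po prof) x + po prof p.2 + po prof q.2 := by
    rw [tot_fl, tot_fl, sg_f _ _ _ hp, sg_f _ _ _ hq']
  by_cases h : 1 ≤ po prof p.2 + po prof q.2
  · have := drop_two H p q hx hn yf (by rw [hpo]; linarith)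
    linarith
  · exfalso
    have hp0 : prof p.2 = 0 := by
      refine le_antisymm (not_lt.mp fun hc => h ?_) (H.hprof _)
      rw [po_pos hc]; linarith [nn01 (po01 (prof := prof)) q.2]
    have hq0 : prof q.2 = 0 := by
      refine le_antisymm (not_lt.mp fun hc => h ?_) (H.hprof _)
      rw [po_pos hc]; linarith [nn01 (po01 (prof := prof)) p.2]
    have hN : NN (fl (fl x p) q) = NN x + 2 := by
      rw [NN_fl, NN_fl]; simp only [hp, hq', Bool.false_eq_true, if_false]; ring
    have hQ : QQ x ≤ QQ (fl (fl x p) q) := by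
      have h1 : 0 ≤ kk x p.1 := by obtain ⟨n, h⟩ := kk_nat x p.1; rw [h]; positivity
      have h2 : 0 ≤ kk (fl x p) q.1 := by obtain ⟨n, h⟩ := kk_nat (fl x p) q.1; rw [h]; positivity
      rw [QQ_fl, QQ_fl]; simp only [hp, hq', Bool.false_eq_true, if_false]; linarith
    have := h3 (by rw [tot_fl, tot_fl, sg_f _ _ _ hp, sg_f _ _ _ hq', hp0, hq0]; simp)
      (by linarith)
    have h4 := H.hd
    have h5 := mul_le_mul_of_nonneg_left hQ H.hc.le
    rw [hN] at this
    nlinarith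

theorem two_down (H : Hyp K m a d c B α prof) {x : Fin K → Fin m → Bool}
    (hx : feasible K m a d c B α x) (hn : ¬ opt a d c B α prof x) (p q : Fin K × Fin m)
    (hpq : p ≠ q) (hp : x p.1 p.2 = true) (hq : x q.1 q.2 = true) :
    0 ≤ DD a d c B α prof x (fl (fl x p) q) := by
  unfold DD
  split_ifs with hA
  swap
  · exact le_rfl
  have hq' : fl x p q.1 q.2 = true := by rw [fl_ne x p q hpq, hq]
  obtain ⟨yf, hpl, h3⟩ := of_acc H.h1 H.ha H.hd H.hc H.hprof hx hA
  rw [tot_fl, tot_fl, sg_t _ _ _ hp, sg_t _ _ _ hq'] at hpl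
  have g1 := H.hprof p.2
  have g2 := H.hprof q.2
  have h0 : prof p.2 = 0 := le_antisymm (by linarith) (H.hprof _)
  have k0 : prof q.2 = 0 := le_antisymm (by linarith) (H.hprof _)
  have f1 := (tau_facts H.hK H.hmono x (miss_of H hx hn)).1
  have hpo : po prof p.2 = 0 := by simp [po, h0]
  have kpo : po prof q.2 = 0 := by simp [po, k0]
  rcases drop_same (y := fl (fl x p) q) H hx hn
    (by rw [tot_fl, tot_fl, sg_t _ _ _ hp, sg_t _ _ _ hq', hpo, kpo]; simp) with h | h
  · linarith
  · rw [h]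
    refine le_trans ?_ (WW_drop (prof := prof) _ x _)
    have eU : UU prof (tau prof x) (fl (fl x p) q) = UU prof (tau prof x) x := by
      unfold UU; rw [tot_fl, tot_fl, sg_t _ _ _ hp, sg_t _ _ _ hq']; simp [ga, h0, k0, not_lt.mpr f1.le]
    have eO : OO prof (tau prof x) (fl (fl x p) q) = OO prof (tau prof x) x := by
      unfold OO; rw [tot_fl, tot_fl, sg_t _ _ _ hp, sg_t _ _ _ hq']; simp [op, h0, k0]
    have eZ : ZZ prof (fl (fl x p) q) = ZZ prof x - 2 := by
      unfold ZZ; rw [tot_fl, tot_fl, sg_t _ _ _ hp, sg_t _ _ _ hq']; simp [ze, h0, k0]; ring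
    have eg : gg prof (tau prof x) (fl (fl x p) q) = gg prof (tau prof x) x := by
      rw [gg_fl0 _ _ _ (by simp [mi, k0, f1.ne]), gg_fl0 _ _ _ (by simp [mi, h0, f1.ne])]
    unfold XX
    rw [eU, eO, eZ, eg]
    rcases th01 (prof := prof) (tau prof x) x with h | h <;> rw [h] <;> linarith

open scoped Classical in
theorem pair_ge (H : Hyp K m a d c B α prof) {x : Fin K → Fin m → Bool}
    (hx : feasible K m a d c B α x) (hn : ¬ opt a d c B α prof x) :
    2 * SS a d c B α prof x ≤ ∑ r ∈ (Finset.univ : Finset (Fin K × Fin m)).offDiag,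
      DD a d c B α prof x (fl (fl x r.1) r.2) := by
  set f : (Fin K × Fin m) × (Fin K × Fin m) → ℝ := fun r =>
    if x r.1.1 r.1.2 = true ∧ x r.2.1 r.2.2 = false then
      DD a d c B α prof x (fl (fl x r.1) r.2) else 0 with hf
  have e1 : SS a d c B α prof x = ∑ r ∈ (Finset.univ : Finset (Fin K × Fin m)).offDiag, f r := by
    unfold SS
    rw [← Fintype.sum_prod_type' (fun s t => f (s, t))]
    symm
    refine Finset.sum_subset (Finset.subset_univ _) ?_
    rintro ⟨s, t⟩ _ hst
    simp only [Finset.mem_offDiag, Finset.mem_univ, true_and, not_not] at hst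
    subst hst
    simp only [hf]
    rw [if_neg]
    rintro ⟨h1, h2⟩
    rw [h1] at h2; cases h2
  have e2 : SS a d c B α prof x =
      ∑ r ∈ (Finset.univ : Finset (Fin K × Fin m)).offDiag, f r.swap := by
    rw [e1]
    refine Finset.sum_nbij' Prod.swap Prod.swap ?_ ?_ ?_ ?_ ?_
    · rintro ⟨s, t⟩ h; simpa [eq_comm] using h
    · rintro ⟨s, t⟩ h; simpa [eq_comm] using h
    · intros; rfl
    · intros; rfl
    · intros; rfl
  rw [two_mul]
  nth_rw 1 [e1]
  rw [e2, ← Finset.sum_add_distrib]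
  refine Finset.sum_le_sum ?_
  rintro ⟨s, t⟩ hst
  simp only [Finset.mem_offDiag, Finset.mem_univ, true_and] at hst
  simp only [hf, Prod.swap]
  cases hs : x s.1 s.2 <;> cases ht : x t.1 t.2
  · simpa using two_up H hx hn s t hst hs ht
  · simp [fl_comm x t s]
  · simp
  · simpa using two_down H hx hn s t hst hs ht
end sums

section drift
variable {K m : ℕ} {a d c B α : ℝ} {prof : Fin m → ℝ}

/-- pairwise contribution -/
noncomputable def PT (prof : Fin m → ℝ) (τ : ℝ) (x : Fin K → Fin m → Bool) (i' i : Fin K) : ℝ :=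
  okr x i' i * th prof τ x * (lin (ov prof τ) (x i') * (∑ j, mi prof τ j - lin (mi prof τ) (x i)))
  + okr x i' i * th prof τ x * (lin (mi prof τ) (x i') * (∑ j, ga prof τ j - lin (ga prof τ) (x i)))
  + okr x i' i * (8 * dd K (OO prof τ x)) *
      (lin (ov prof τ) (x i') * (∑ j, mi prof τ j - lin (mi prof τ) (x i)))
  + okr x i' i * (8 * dd K (OO prof τ x)) *
      (lin (ov prof τ) (x i') * (∑ j, ga prof τ j - lin (ga prof τ) (x i)))
  + okr x i' i * (8 * dd K (UU prof τ x)) *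
      (lin (mi prof τ) (x i') * (∑ j, ga prof τ j - lin (ga prof τ) (x i)))
  + okr x i' i * (8 * dd K (UU prof τ x)) *
      (lin (ov prof τ) (x i') * (∑ j, ga prof τ j - lin (ga prof τ) (x i)))
  + okq x i' i * (th prof τ x * ((lin (mi prof τ) (x i') - lin (mi prof τ) (x i) - 1)
        / ∑ j, mi prof τ j)) *
      (lin (mi prof τ) (x i') * (∑ j, mi prof τ j - lin (mi prof τ) (x i)))

theorem SS_ge (H : Hyp K m a d c B α prof) {x : Fin K → Fin m → Bool}
    (hx : feasible K m a d c B α x) (hn : ¬ opt a d c B α prof x) {τ : ℝ} (hτ : τ = tau prof x) :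
    ∑ i', ∑ i, PT prof τ x i' i ≤ SS a d c B α prof x := by
  unfold PT
  simp only [Finset.sum_add_distrib]
  rw [← sum_prod x (fun i' i => okr x i' i * th prof τ x) (ov prof τ) (mi prof τ),
    ← sum_prod x (fun i' i => okr x i' i * th prof τ x) (mi prof τ) (ga prof τ),
    ← sum_prod x (fun i' i => okr x i' i * (8 * dd K (OO prof τ x))) (ov prof τ) (mi prof τ),
    ← sum_prod x (fun i' i => okr x i' i * (8 * dd K (OO prof τ x))) (ov prof τ) (ga prof τ),
    ← sum_prod x (fun i' i => okr x i' i * (8 * dd K (UU prof τ x))) (mi prof τ) (ga prof τ),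
    ← sum_prod x (fun i' i => okr x i' i * (8 * dd K (UU prof τ x))) (ov prof τ) (ga prof τ),
    ← sum_prod x (fun i' i => okq x i' i * (th prof τ x *
      ((lin (mi prof τ) (x i') - lin (mi prof τ) (x i) - 1) / ∑ j, mi prof τ j)))
      (mi prof τ) (mi prof τ)]
  simp only [← Finset.sum_add_distrib]
  unfold SS
  refine Finset.sum_le_sum fun s _ => Finset.sum_le_sum fun t _ => ?_
  split_ifs with h
  · refine le_trans (le_of_eq ?_) (swap_lb H hx hn s t h.1 h.2 hτ)
    unfold AA
    ring
  · simp

theorem kk_eq (τ : ℝ) (x : Fin K → Fin m → Bool) (i : Fin K) :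
    kk x i = lin (ga prof τ) (x i) + lin (mi prof τ) (x i) + lin (ov prof τ) (x i) := by
  rw [← lin_add, ← lin_add]
  unfold kk
  congr 1
  funext j
  rcases cls (prof := prof) τ j with ⟨_, h1, h2, h3⟩ | ⟨_, h1, h2, h3⟩ | ⟨_, h1, h2, h3⟩ <;>
    rw [h1, h2, h3] <;> norm_num

theorem po_eq {τ : ℝ} (hτ : 0 < τ) (x : Fin K → Fin m → Bool) :
    tot (po prof) x = tot (ga prof τ) x + tot (mi prof τ) x + OO prof τ x := by
  unfold OO
  rw [← tot_add, ← tot_add]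
  congr 1
  funext j
  rw [op_eq]
  rcases cls (prof := prof) τ j with ⟨h0, h1, h2, h3⟩ | ⟨h0, h1, h2, h3⟩ | ⟨h0, h1, h2, h3⟩ <;>
    rw [h1, h2, h3]
  · rw [po_pos (by linarith)]; norm_num
  · rw [po_pos (by linarith)]; norm_num
  · norm_num

theorem ov_eq {τ : ℝ} (hτ : 0 < τ) (x : Fin K → Fin m → Bool) :
    tot (ov prof τ) x = OO prof τ x + ZZ prof x := by
  unfold OO ZZ
  rw [← tot_add]
  congr 1
  funext j
  unfold ov op ze
  split_ifs <;> grind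

theorem sum_nat' {f : Fin m → ℝ} (hf : ∀ j, f j = 0 ∨ f j = 1) : ∃ n : ℕ, ∑ j, f j = n := by
  obtain ⟨n, h⟩ := lin_nat f hf (fun _ => true)
  exact ⟨n, by simpa [lin] using h⟩

theorem mis_nat {f : Fin m → ℝ} (hf : ∀ j, f j = 0 ∨ f j = 1) (r : Fin m → Bool) :
    ∃ n : ℕ, ∑ j, f j - lin f r = n := by
  obtain ⟨n, h⟩ := sum_nat' hf
  obtain ⟨k, h'⟩ := lin_nat f hf r
  have := lin_le f (nn01 hf) r
  rw [h, h'] at this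
  refine ⟨n - k, ?_⟩
  rw [h, h', Nat.cast_sub (by exact_mod_cast this)]

theorem nat_add {a b : ℝ} (ha : ∃ n : ℕ, a = n) (hb : ∃ n : ℕ, b = n) : ∃ n : ℕ, a + b = n := by
  obtain ⟨n, rfl⟩ := ha
  obtain ⟨k, rfl⟩ := hb
  exact ⟨n + k, by push_cast; rfl⟩

theorem UU_sum (τ : ℝ) (x : Fin K → Fin m → Bool) :
    UU prof τ x = ∑ i, (∑ j, ga prof τ j - lin (ga prof τ) (x i)) := by
  unfold UU tot
  rw [Finset.sum_sub_distrib]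
  simp

theorem okr01 (x : Fin K → Fin m → Bool) (i' i : Fin K) : okr x i' i = 0 ∨ okr x i' i = 1 := by
  unfold okr; split_ifs <;> simp

theorem PT_ge (hK : 1 ≤ K) {τ : ℝ} (hw : 1 ≤ ∑ j, mi prof τ j) (x : Fin K → Fin m → Bool) (i' i : Fin K) :
    8 * dd K (OO prof τ x) * (okr x i' i * (lin (ov prof τ) (x i') *
      ((∑ j, mi prof τ j - lin (mi prof τ) (x i)) + (∑ j, ga prof τ j - lin (ga prof τ) (x i)))))
    + 8 * dd K (UU prof τ x) * (okr x i' i * ((lin (mi prof τ) (x i') + lin (ov prof τ) (x i')) *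
        (∑ j, ga prof τ j - lin (ga prof τ) (x i)))) ≤ PT prof τ x i' i := by
  have hk' := kk_eq (prof := prof) τ x i'
  have hk := kk_eq (prof := prof) τ x i
  have o0 := lin_nonneg (ov prof τ) (nn01 ov01) (x i)
  have o0' := lin_nonneg (ov prof τ) (nn01 ov01) (x i')
  have c0 := lin_nonneg (mi prof τ) (nn01 mi01) (x i)
  have c0' := lin_nonneg (mi prof τ) (nn01 mi01) (x i')
  have c1 := lin_le (mi prof τ) (nn01 mi01) (x i)
  have c1' := lin_le (mi prof τ) (nn01 mi01) (x i')
  have g1 := lin_le (ga prof τ) (nn01 ga01) (x i)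
  have g1' := lin_le (ga prof τ) (nn01 ga01) (x i')
  have hth0 : 0 ≤ th prof τ x := by rcases th01 (prof := prof) τ x with h | h <;> rw [h] <;> norm_num
  unfold PT
  set o' := lin (ov prof τ) (x i')
  set o := lin (ov prof τ) (x i)
  set c' := lin (mi prof τ) (x i')
  set cc := lin (mi prof τ) (x i)
  set g' := lin (ga prof τ) (x i')
  set g := lin (ga prof τ) (x i)
  set w := ∑ j, mi prof τ j
  set r := ∑ j, ga prof τ j
  set θ := th prof τ x
  have key : 0 ≤ okr x i' i * θ * (o' * (w - cc)) + okr x i' i * θ * (c' * (r - g))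
      + okq x i' i * (θ * ((c' - cc - 1) / w)) * (c' * (w - cc)) := by
    have p1 : 0 ≤ o' * (w - cc) := mul_nonneg o0' (by linarith)
    have p2 : 0 ≤ c' * (r - g) := mul_nonneg c0' (by linarith)
    have p3 : 0 ≤ c' * (w - cc) := mul_nonneg c0' (by linarith)
    by_cases h : kk x i + 1 ≤ kk x i'
    · have h1 : okr x i' i = 1 := by unfold okr; rw [if_pos (Or.inr h)]
      have h2 : okq x i' i = 1 := by unfold okq; rw [if_pos h]
      rw [h1, h2]
      have e : 1 * θ * (o' * (w - cc)) + 1 * θ * (c' * (r - g))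
        + 1 * (θ * ((c' - cc - 1) / w)) * (c' * (w - cc)) =
        θ * ((o' * (w - cc) + c' * (r - g)) * w + (c' - cc - 1) * (c' * (w - cc))) / w := by
        field_simp
      rw [e]
      refine div_nonneg (mul_nonneg hth0 ?_) (by linarith)
      have q1 : -(o' + (r - g)) * (c' * (w - cc)) ≤ (c' - cc - 1) * (c' * (w - cc)) :=
        mul_le_mul_of_nonneg_right (by linarith) p3
      have q2 : o' * (w - cc) * c' ≤ o' * (w - cc) * w := mul_le_mul_of_nonneg_left c1' p1
      have q3 : c' * (r - g) * (w - cc) ≤ c' * (r - g) * w :=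
        mul_le_mul_of_nonneg_left (by linarith) p2
      nlinarith
    · have h2 : okq x i' i = 0 := by unfold okq; rw [if_neg h]
      rw [h2]
      have h3 : 0 ≤ okr x i' i := by rcases okr01 x i' i with h | h <;> rw [h] <;> norm_num
      have := mul_nonneg (mul_nonneg h3 hth0) p1
      have := mul_nonneg (mul_nonneg h3 hth0) p2
      linarith
  linarith

theorem PT_nonneg (hK : 1 ≤ K) {τ : ℝ} (hw : 1 ≤ ∑ j, mi prof τ j) (x : Fin K → Fin m → Bool)
    (i' i : Fin K) : 0 ≤ PT prof τ x i' i := by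
  refine le_trans ?_ (PT_ge hK hw x i' i)
  have h3 : 0 ≤ okr x i' i := by rcases okr01 x i' i with h | h <;> rw [h] <;> norm_num
  have o0' := lin_nonneg (ov prof τ) (nn01 ov01) (x i')
  have c0' := lin_nonneg (mi prof τ) (nn01 mi01) (x i')
  have c1 := sub_nonneg.mpr (lin_le (mi prof τ) (nn01 mi01) (x i))
  have g1 := sub_nonneg.mpr (lin_le (ga prof τ) (nn01 ga01) (x i))
  have d1 := dd_nonneg hK (OO prof τ x)
  have d2 := dd_nonneg hK (UU prof τ x)
  positivity

/-- swaps suffice if U or O is positive -/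
theorem SS_UO (H : Hyp K m a d c B α prof) {x : Fin K → Fin m → Bool}
    (hx : feasible K m a d c B α x) (hn : ¬ opt a d c B α prof x) {τ : ℝ} (hτ : τ = tau prof x)
    (h : 0 < UU prof τ x ∨ 0 < OO prof τ x) : 1 ≤ SS a d c B α prof x := by
  obtain ⟨f1, f2, f3, f4, f5⟩ := tau_facts H.hK H.hmono x (miss_of H hx hn)
  rw [← hτ] at f1 f2 f3 f4
  refine le_trans ?_ (SS_ge H hx hn hτ)
  have hpe := po_eq (prof := prof) f1 x
  have hge := ge_split (prof := prof) (τ := τ)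
  have hov := ov_eq (prof := prof) f1 x
  have hZ := ZZ_nonneg (prof := prof) x
  have h3 : ∀ i' i, 0 ≤ okr x i' i := fun i' i => by
    rcases okr01 x i' i with h | h <;> rw [h] <;> norm_num
  have o0' := fun i => lin_nonneg (ov prof τ) (nn01 ov01) (x i)
  have c0' := fun i => lin_nonneg (mi prof τ) (nn01 mi01) (x i)
  have c1 := fun i => sub_nonneg.mpr (lin_le (mi prof τ) (nn01 mi01) (x i))
  have g1 := fun i => sub_nonneg.mpr (lin_le (ga prof τ) (nn01 ga01) (x i))
  have d1 := dd_nonneg H.hK (OO prof τ x)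
  have d2 := dd_nonneg H.hK (UU prof τ x)
  have hT : 8 * dd K (OO prof τ x) * ∑ i', ∑ i, (okr x i' i * (lin (ov prof τ) (x i') *
      ((∑ j, mi prof τ j - lin (mi prof τ) (x i)) + (∑ j, ga prof τ j - lin (ga prof τ) (x i)))))
    + 8 * dd K (UU prof τ x) * ∑ i', ∑ i, (okr x i' i *
        ((lin (mi prof τ) (x i') + lin (ov prof τ) (x i')) *
        (∑ j, ga prof τ j - lin (ga prof τ) (x i)))) ≤ ∑ i', ∑ i, PT prof τ x i' i := by
    simp only [Finset.mul_sum, ← Finset.sum_add_distrib]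
    refine Finset.sum_le_sum fun i' _ => Finset.sum_le_sum fun i _ => ?_
    have := PT_ge H.hK f4 x i' i
    simpa only [Finset.mul_sum] using this
  refine le_trans ?_ hT
  have n1 : 0 ≤ ∑ i', ∑ i, (okr x i' i * (lin (ov prof τ) (x i') *
      ((∑ j, mi prof τ j - lin (mi prof τ) (x i)) + (∑ j, ga prof τ j - lin (ga prof τ) (x i))))) :=
    Finset.sum_nonneg fun i' _ => Finset.sum_nonneg fun i _ =>
      mul_nonneg (h3 _ _) (mul_nonneg (o0' _) (add_nonneg (c1 _) (g1 _)))
  have n2 : 0 ≤ ∑ i', ∑ i, (okr x i' i *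
        ((lin (mi prof τ) (x i') + lin (ov prof τ) (x i')) *
        (∑ j, ga prof τ j - lin (ga prof τ) (x i)))) :=
    Finset.sum_nonneg fun i' _ => Finset.sum_nonneg fun i _ =>
      mul_nonneg (h3 _ _) (mul_nonneg (add_nonneg (c0' _) (o0' _)) (g1 _))
  have n1' := mul_nonneg (mul_nonneg (by norm_num : (0:ℝ) ≤ 8) d1) n1
  have n2' := mul_nonneg (mul_nonneg (by norm_num : (0:ℝ) ≤ 8) d2) n2
  have hG1 : ∀ i' i, (i' = i ∨ kk x i + 1 ≤ kk x i') → okr x i' i = 1 := fun i' i h => by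
    unfold okr; rw [if_pos h]
  have hG0 : ∀ i' i, ¬ (i' = i ∨ kk x i + 1 ≤ kk x i') → okr x i' i = 0 := fun i' i h => by
    unfold okr; rw [if_neg h]
  rcases h with h | h
  · have hU1 : 1 ≤ UU prof τ x := by
      obtain ⟨n, hn1⟩ := sum_nat' (ga01 (prof := prof) (τ := τ))
      obtain ⟨k, hk1⟩ := tot_nat (ga prof τ) ga01 x
      unfold UU at h ⊢
      rw [hn1, hk1] at h ⊢
      have : k < K * n := by
        have : (k:ℝ) < K * n := by linarith
        exact_mod_cast this
      have : ((k + 1 : ℕ) : ℝ) ≤ ((K * n : ℕ) : ℝ) := by exact_mod_cast this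
      push_cast at this
      linarith
    have := count_lemma H.hK (fun i => lin (mi prof τ) (x i) + lin (ov prof τ) (x i))
      (fun i => ∑ j, ga prof τ j - lin (ga prof τ) (x i)) (kk x) (∑ j, ga prof τ j) (UU prof τ x)
      (fun i => nat_add (lin_nat _ mi01 _) (lin_nat _ ov01 _)) (fun i => mis_nat ga01 _)
      (kk_nat x) (fun i => by rw [kk_eq (prof := prof) τ x i]; ring) hU1
      (by
        rw [Finset.sum_add_distrib]
        change UU prof τ x ≤ tot (mi prof τ) x + tot (ov prof τ) x
        unfold UU
        linarith) (by rw [← UU_sum]) (okr x) hG1 hG0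
    linarith
  · have hO1 : 1 ≤ OO prof τ x := by
      obtain ⟨k, hk1⟩ := tot_nat (op prof τ) op01 x
      unfold OO at h ⊢
      rw [hk1] at h ⊢
      have : 0 < k := by exact_mod_cast h
      exact_mod_cast this
    have := count_lemma H.hK (fun i => lin (ov prof τ) (x i))
      (fun i => (∑ j, mi prof τ j - lin (mi prof τ) (x i)) +
        (∑ j, ga prof τ j - lin (ga prof τ) (x i))) (kk x) (∑ j, ge prof τ j) (OO prof τ x)
      (fun i => lin_nat _ ov01 _) (fun i => nat_add (mis_nat mi01 _) (mis_nat ga01 _))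
      (kk_nat x) (fun i => by rw [kk_eq (prof := prof) τ x i, hge]; ring) hO1
      (by
        change OO prof τ x ≤ tot (ov prof τ) x
        linarith)
      (by
        rw [Finset.sum_add_distrib, ← UU_sum, Finset.sum_sub_distrib]
        simp only [Finset.sum_const, Finset.card_univ, Fintype.card_fin, nsmul_eq_mul]
        change OO prof τ x ≤ K * ∑ j, mi prof τ j - tot (mi prof τ) x + UU prof τ x
        unfold UU
        rw [hge] at f3
        linarith) (okr x) hG1 hG0
    linarith
end drift

section fin
variable {K m : ℕ} {a d c B α : ℝ} {prof : Fin m → ℝ}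

theorem sum_zero_each {f : Fin K → ℝ} (hf : ∀ i, 0 ≤ f i) (h : ∑ i, f i = 0) (i : Fin K) : f i = 0 :=
  (Finset.sum_eq_zero_iff_of_nonneg fun i _ => hf i).mp h i (Finset.mem_univ i)

/-- well-sorted but unbalanced -/
theorem SS_unbal (H : Hyp K m a d c B α prof) {x : Fin K → Fin m → Bool}
    (hx : feasible K m a d c B α x) (hn : ¬ opt a d c B α prof x) {τ : ℝ} (hτ : τ = tau prof x)
    (hU : UU prof τ x = 0) (hO : OO prof τ x = 0) (hZ : ZZ prof x = 0)
    (i' i : Fin K) (hi : kk x i + 2 ≤ kk x i') : 1 ≤ SS a d c B α prof x := by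
  obtain ⟨f1, f2, f3, f4, f5⟩ := tau_facts H.hK H.hmono x (miss_of H hx hn)
  rw [← hτ] at f1 f2 f3 f4
  refine le_trans ?_ (SS_ge H hx hn hτ)
  have hP : PT prof τ x i' i ≤ ∑ i', ∑ i, PT prof τ x i' i := by
    refine le_trans (Finset.single_le_sum (f := fun i => PT prof τ x i' i)
      (fun i _ => PT_nonneg H.hK f4 x i' i) (Finset.mem_univ i)) ?_
    exact Finset.single_le_sum (f := fun i' => ∑ i, PT prof τ x i' i)
      (fun i' _ => Finset.sum_nonneg fun i _ => PT_nonneg H.hK f4 x i' i) (Finset.mem_univ i')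
  refine le_trans ?_ hP
  have hov := ov_eq (prof := prof) f1 x
  rw [hO, hZ, add_zero] at hov
  have ho := fun i => sum_zero_each (fun i => lin_nonneg (ov prof τ) (nn01 ov01) (x i)) hov i
  rw [UU_sum] at hU
  have hu := fun i => sum_zero_each
    (fun i => sub_nonneg.mpr (lin_le (ga prof τ) (nn01 ga01) (x i))) hU i
  have hth : th prof τ x = 1 := by
    unfold th
    rw [if_pos]
    unfold XX
    rw [UU_sum, hU, hO, hZ]
    unfold gg
    simp only [mul_zero, add_zero]
    rw [div_le_iff₀ (by linarith)]
    calc ∑ i, FF (lin (mi prof τ) (x i)) ≤ ∑ _i : Fin K, (∑ j, mi prof τ j) * (∑ j, mi prof τ j) := by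
          refine Finset.sum_le_sum fun i _ => ?_
          have c0 := lin_nonneg (mi prof τ) (nn01 mi01) (x i)
          have c1 := lin_le (mi prof τ) (nn01 mi01) (x i)
          unfold FF
          nlinarith
      _ = _ := by simp; ring
  have hk' := kk_eq (prof := prof) τ x i'
  have hk := kk_eq (prof := prof) τ x i
  have c0 := lin_nonneg (mi prof τ) (nn01 mi01) (x i)
  have c0' := lin_nonneg (mi prof τ) (nn01 mi01) (x i')
  have c1 := lin_le (mi prof τ) (nn01 mi01) (x i)
  have c1' := lin_le (mi prof τ) (nn01 mi01) (x i')
  have hu1 := hu i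
  have hu2 := hu i'
  have ho1 := ho i
  have ho2 := ho i'
  unfold PT
  rw [hu1, ho2, hth]
  have h2 : okq x i' i = 1 := by unfold okq; rw [if_pos (by linarith)]
  rw [h2]
  rw [ho2] at hk'
  rw [ho1] at hk
  set c' := lin (mi prof τ) (x i')
  set cc := lin (mi prof τ) (x i)
  set w := ∑ j, mi prof τ j
  have hd : cc + 2 ≤ c' := by linarith
  simp only [zero_mul, mul_zero, zero_add, one_mul, add_zero]
  rw [div_mul_eq_mul_div, le_div_iff₀ (by linarith), one_mul]
  have e1 : 1 * (c' * (w - cc)) ≤ (c' - cc - 1) * (c' * (w - cc)) :=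
    mul_le_mul_of_nonneg_right (by linarith) (mul_nonneg c0' (by linarith))
  have e2 : (cc + 2) * (w - cc) ≤ c' * (w - cc) := mul_le_mul_of_nonneg_right hd (by linarith)
  have e3 : 0 ≤ cc * (w - cc - 2) := mul_nonneg c0 (by linarith)
  nlinarith

theorem QQ_tangent (z : Fin K → Fin m → Bool) (q : ℕ) :
    2 * q * NN z - K * (q * (q + 1)) ≤ QQ z := by
  have : 2 * (q:ℝ) * NN z - K * (q * (q + 1)) = ∑ i, (2 * q * kk z i - q * (q + 1)) := by
    rw [Finset.sum_sub_distrib, ← Finset.mul_sum]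
    simp [NN, tot, kk]
  rw [this]
  unfold QQ
  refine Finset.sum_le_sum fun i _ => ?_
  obtain ⟨n, hn⟩ := kk_nat z i
  change 2 * (q:ℝ) * kk z i - q * (q + 1) ≤ (kk z i)^2 - kk z i
  rw [hn]
  have h : (0:ℝ) ≤ ((n:ℝ) - q) * ((n:ℝ) - q - 1) := by
    rcases le_or_gt n q with h | h
    · have : (n:ℝ) ≤ q := by exact_mod_cast h
      nlinarith
    · have : (q:ℝ) + 1 ≤ n := by exact_mod_cast h
      apply mul_nonneg <;> linarith
  nlinarith

theorem QQ_bal (z : Fin K → Fin m → Bool) (q : ℕ) (h : ∀ i, kk z i = q ∨ kk z i = q + 1) :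
    QQ z = 2 * q * NN z - K * (q * (q + 1)) := by
  have : 2 * (q:ℝ) * NN z - K * (q * (q + 1)) = ∑ i, (2 * q * kk z i - q * (q + 1)) := by
    rw [Finset.sum_sub_distrib, ← Finset.mul_sum]
    simp [NN, tot, kk]
  rw [this]
  unfold QQ
  refine Finset.sum_congr rfl fun i _ => ?_
  change (kk z i)^2 - kk z i = 2 * (q:ℝ) * kk z i - q * (q + 1)
  rcases h i with h | h <;> rw [h] <;> ring

theorem tot_prof_le (τ : ℝ) (hτ : 0 < τ) (z : Fin K → Fin m → Bool) :
    tot prof z ≤ K * ∑ j, (ga prof τ j * (prof j - τ)) + τ * NN z := by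
  have hnn : ∀ j, 0 ≤ ga prof τ j * (prof j - τ) := fun j => by
    unfold ga; split_ifs with h <;> linarith
  have := tot_le (fun j => ga prof τ j * (prof j - τ)) hnn z
  have h2 : tot prof z ≤ tot (fun j => ga prof τ j * (prof j - τ)) z + τ * NN z := by
    unfold NN tot lin
    rw [Finset.mul_sum, ← Finset.sum_add_distrib]
    refine Finset.sum_le_sum fun i _ => ?_
    rw [Finset.mul_sum, ← Finset.sum_add_distrib]
    refine Finset.sum_le_sum fun j _ => ?_
    dsimp only [ga]
    split_ifs <;> linarith
  linarith

theorem mem_of_mis_zero {f : Fin m → ℝ} (hf : ∀ j, 0 ≤ f j) (r : Fin m → Bool)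
    (h : ∑ j, f j - lin f r = 0) (j : Fin m) (hj : 0 < f j) : r j = true := by
  rw [lin_add_mis] at h
  have := (Finset.sum_eq_zero_iff_of_nonneg (fun j _ => by split_ifs <;> simp [hf])).mp h j
    (Finset.mem_univ j)
  cases hr : r j
  · rw [hr] at this; simp at this; linarith
  · rfl

theorem not_mem_of_zero {f : Fin m → ℝ} (hf : ∀ j, 0 ≤ f j) (r : Fin m → Bool)
    (h : lin f r = 0) (j : Fin m) (hj : 0 < f j) : r j = false := by
  unfold lin at h
  have := (Finset.sum_eq_zero_iff_of_nonneg (fun j _ => by split_ifs <;> simp [hf])).mp h j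
    (Finset.mem_univ j)
  cases hr : r j
  · rfl
  · rw [hr] at this; simp at this; linarith

/-- sorted and balanced: a single flip improves -/
theorem bal_up (H : Hyp K m a d c B α prof) {x : Fin K → Fin m → Bool}
    (hx : feasible K m a d c B α x) (hn : ¬ opt a d c B α prof x) {τ : ℝ} (hτ : τ = tau prof x)
    (hU : UU prof τ x = 0) (hO : OO prof τ x = 0) (hZ : ZZ prof x = 0)
    (hbal : ∀ i' i, kk x i' < kk x i + 2) :
    ∃ p, 20 ≤ DD a d c B α prof x (fl x p) := by
  obtain ⟨f1, f2, f3, f4, f5⟩ := tau_facts H.hK H.hmono x (miss_of H hx hn)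
  rw [← hτ] at f1 f2 f3 f4
  have hpe := po_eq (prof := prof) f1 x
  have hov := ov_eq (prof := prof) f1 x
  rw [hO, hZ, add_zero] at hov
  have ho := fun i => sum_zero_each (fun i => lin_nonneg (ov prof τ) (nn01 ov01) (x i)) hov i
  have hU' := hU
  rw [UU_sum] at hU
  have hu := fun i => sum_zero_each
    (fun i => sub_nonneg.mpr (lin_le (ga prof τ) (nn01 ga01) (x i))) hU i
  haveI : Nonempty (Fin K) := ⟨⟨0, H.hK⟩⟩
  obtain ⟨i0, hi0⟩ := Finite.exists_min (kk x)
  have hkk := kk_eq (prof := prof) τ x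
  -- missing middle item
  have hmis : ∃ j, x i0 j = false ∧ mi prof τ j = 1 := by
    by_contra hcon
    push Not at hcon
    have hz : ∑ j, mi prof τ j - lin (mi prof τ) (x i0) = 0 := by
      rw [lin_add_mis]
      refine Finset.sum_eq_zero fun j _ => ?_
      split_ifs with h
      · rcases mi01 (prof := prof) (τ := τ) j with h' | h'
        · exact h'
        · exact absurd h' (hcon j h)
      · rfl
    have : K * ∑ j, mi prof τ j ≤ tot (mi prof τ) x := by
      unfold tot
      calc (K:ℝ) * ∑ j, mi prof τ j = ∑ _i : Fin K, ∑ j, mi prof τ j := by simp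
        _ ≤ _ := Finset.sum_le_sum fun i _ => by
          have h1 := hi0 i
          rw [hkk, hkk i, ho, ho] at h1
          linarith [hu i, hu i0]
    rw [ge_split] at f3
    unfold UU at hU'
    linarith
  obtain ⟨j0, hj1, hj2⟩ := hmis
  have hpj : prof j0 = τ := by
    unfold mi at hj2; split_ifs at hj2 with h
    · exact h
    · norm_num at hj2
  refine ⟨(i0, j0), ?_⟩
  set y := fl x (i0, j0) with hy
  have hNy : NN y = NN x + 1 := by rw [hy, NN_fl]; simp [hj1]
  obtain ⟨q, hq⟩ := kk_nat x i0
  have hybal : ∀ i, kk y i = q ∨ kk y i = q + 1 := by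
    intro i
    rw [hy, kk_fl]
    by_cases h : i = i0
    · right; subst h; simp [hj1, hq]
    · have h1 := hi0 i
      have h2 := hbal i i0
      obtain ⟨n, hn'⟩ := kk_nat x i
      simp only [h, if_false, add_zero]
      rw [hn', hq] at h1 h2
      have h1' : q ≤ n := by exact_mod_cast h1
      have h2' : n < q + 2 := by exact_mod_cast h2
      rw [hn']
      have : n = q ∨ n = q + 1 := by omega
      rcases this with h | h <;> rw [h]
      · left; rfl
      · right; push_cast; rfl
  -- better solution
  have : ∃ z, feasible K m a d c B α z ∧ tot prof x < tot prof z := by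
    by_contra hcon
    push Not at hcon
    exact hn ⟨hx, hcon⟩
  obtain ⟨z, zf, hz⟩ := this
  have hxe : tot prof x = K * ∑ j, (ga prof τ j * (prof j - τ)) + τ * NN x := by
    unfold NN tot
    have : (K:ℝ) * ∑ j, (ga prof τ j * (prof j - τ)) =
      ∑ _i : Fin K, ∑ j, (ga prof τ j * (prof j - τ)) := by simp
    rw [this, Finset.mul_sum, ← Finset.sum_add_distrib]
    refine Finset.sum_congr rfl fun i _ => ?_
    unfold lin
    rw [Finset.mul_sum, ← Finset.sum_add_distrib]
    refine Finset.sum_congr rfl fun j _ => ?_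
    rcases cls (prof := prof) τ j with ⟨h0, h1, h2, h3⟩ | ⟨h0, h1, h2, h3⟩ | ⟨h0, h1, h2, h3⟩
    · have := mem_of_mis_zero (nn01 ga01) (x i) (hu i) j (by rw [h1]; norm_num)
      simp [this, h1]
    · rw [h1, h0]; split_ifs <;> ring
    · have := not_mem_of_zero (nn01 ov01) (x i) (ho i) j (by rw [h3]; norm_num)
      simp [this, h1]
  have hNz : NN y ≤ NN z := by
    have := tot_prof_le (prof := prof) τ f1 z
    have h1 : τ * NN x < τ * NN z := by linarith
    have h2 : NN x < NN z := lt_of_mul_lt_mul_left h1 f1.le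
    rw [hNy, ← NN_eq, ← NN_eq]
    rw [← NN_eq, ← NN_eq] at h2
    exact_mod_cast h2
  have hQz : QQ y ≤ QQ z := by
    refine le_trans ?_ (QQ_tangent z q)
    rw [QQ_bal y q hybal]
    have : 2 * (q:ℝ) * NN y ≤ 2 * q * NN z := by gcongr
    linarith
  have yf : feasible K m a d c B α y := feas_mono H.ha H.hd H.hc zf hNz hQz
  have hA : fge K m a d c B α (fun _ j => prof j) y x := by
    refine acc_of_feas H.h1 hx yf ?_
    rw [hy, tot_fl, sg_f _ _ _ hj1, hpj]
    linarith
  unfold DD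
  rw [if_pos hA]
  refine drop_one H _ hx hn yf ?_
  rw [tot_fl, sg_f _ _ _ hj1, po_pos (by simp only [hpj]; exact f1)]

/-- combined: either a single flip gains at least 2 or swaps gain at least 1 -/
theorem progress (H : Hyp K m a d c B α prof) {x : Fin K → Fin m → Bool}
    (hx : feasible K m a d c B α x) (hn : ¬ opt a d c B α prof x) :
    (∃ p, 2 ≤ DD a d c B α prof x (fl x p)) ∨ 1 ≤ SS a d c B α prof x := by
  by_cases hZ : 0 < ZZ prof x
  · left
    have : ∃ p : Fin K × Fin m, x p.1 p.2 = true ∧ prof p.2 = 0 := by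
      by_contra hcon
      push Not at hcon
      have : ZZ prof x = 0 := by
        unfold ZZ tot lin
        refine Finset.sum_eq_zero fun i _ => Finset.sum_eq_zero fun j _ => ?_
        split_ifs with h
        · have h1 := hcon (i, j) h
          have h2 := lt_of_le_of_ne (H.hprof j) (Ne.symm h1)
          simp [ze, h2]
        · rfl
      linarith
    obtain ⟨p, h1, h2⟩ := this
    exact ⟨p, one_zero H hx hn p h1 h2⟩
  have hZ0 : ZZ prof x = 0 := le_antisymm (not_lt.mp hZ) (ZZ_nonneg x)
  by_cases hUO : 0 < UU prof (tau prof x) x ∨ 0 < OO prof (tau prof x) x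
  · right; exact SS_UO H hx hn rfl hUO
  push Not at hUO
  have hU0 := le_antisymm hUO.1 (UU_nonneg x)
  have hO0 := le_antisymm hUO.2 (OO_nonneg x)
  by_cases hb : ∀ i' i, kk x i' < kk x i + 2
  · left
    obtain ⟨p, hp⟩ := bal_up H hx hn rfl hU0 hO0 hZ0 hb
    exact ⟨p, by linarith⟩
  · push Not at hb
    obtain ⟨i', i, h⟩ := hb
    right; exact SS_unbal H hx hn rfl hU0 hO0 hZ0 i' i h

end fin

section final
variable {K m : ℕ} {a d c B α : ℝ} {prof : Fin m → ℝ}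

open scoped Classical in
noncomputable def PP (a d c B α : ℝ) (prof : Fin m → ℝ) (x : Fin K → Fin m → Bool) : ℝ :=
  if opt a d c B α prof x then 0
  else if feasible K m a d c B α x then ((K:ℝ) * m) ^ 2 * TT prof x
  else 116 * ((K:ℝ) * m) ^ 3 + 2 * ((K:ℝ) * m) * NN x

theorem n_ge (H : Hyp K m a d c B α prof) : (1:ℝ) ≤ (K:ℝ) * m := by
  have h1 : (1:ℝ) ≤ K := by exact_mod_cast H.hK
  have h2 : (1:ℝ) ≤ m := by exact_mod_cast H.hm
  nlinarith

theorem PP_feas {x : Fin K → Fin m → Bool} (hx : feasible K m a d c B α x) :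
    PP a d c B α prof x = ((K:ℝ) * m) ^ 2 * Tp a d c B α prof x := by
  unfold PP Tp
  split_ifs <;> simp

theorem PP_inf {x : Fin K → Fin m → Bool} (hx : ¬ feasible K m a d c B α x) :
    PP a d c B α prof x = 116 * ((K:ℝ) * m) ^ 3 + 2 * ((K:ℝ) * m) * NN x := by
  unfold PP
  rw [if_neg (fun h => hx h.1), if_neg hx]

theorem Tp_bd (H : Hyp K m a d c B α prof) {x : Fin K → Fin m → Bool}
    (hx : feasible K m a d c B α x) :
    0 ≤ Tp a d c B α prof x ∧ Tp a d c B α prof x ≤ 116 * ((K:ℝ) * m) := by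
  have h := n_ge H
  unfold Tp
  split_ifs with ho
  · constructor
    · exact le_rfl
    · linarith
  · have := TT_ge80 H hx ho
    exact ⟨by linarith, TT_le H.hK H.hm x⟩

theorem PP_bd (H : Hyp K m a d c B α prof) {x : Fin K → Fin m → Bool}
    (hx : feasible K m a d c B α x) :
    0 ≤ PP a d c B α prof x ∧ PP a d c B α prof x ≤ 116 * ((K:ℝ) * m) ^ 3 := by
  obtain ⟨h1, h2⟩ := Tp_bd H hx
  rw [PP_feas hx]
  have h3 : 0 ≤ ((K:ℝ) * m) ^ 2 := by positivity
  refine ⟨mul_nonneg h3 h1, ?_⟩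
  have := mul_le_mul_of_nonneg_left h2 h3
  linarith [this, (by ring : ((K:ℝ) * m) ^ 2 * (116 * ((K:ℝ) * m)) = 116 * ((K:ℝ) * m) ^ 3)]

theorem PP_nonneg (H : Hyp K m a d c B α prof) (x : Fin K → Fin m → Bool) :
    0 ≤ PP a d c B α prof x := by
  by_cases hx : feasible K m a d c B α x
  · exact (PP_bd H hx).1
  · rw [PP_inf hx]
    have := NN_nonneg x
    positivity

theorem NN_le (x : Fin K → Fin m → Bool) : NN x ≤ (K:ℝ) * m := by
  have := tot_le (fun _ => (1:ℝ)) (fun _ => zero_le_one) x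
  simpa [NN] using this

theorem PP_le (H : Hyp K m a d c B α prof) (x : Fin K → Fin m → Bool) :
    PP a d c B α prof x ≤ 118 * ((K:ℝ) * m) ^ 3 := by
  have h := n_ge H
  by_cases hx : feasible K m a d c B α x
  · have := (PP_bd H hx).2
    have : 0 ≤ ((K:ℝ) * m) ^ 3 := by positivity
    linarith
  · rw [PP_inf hx]
    have h1 := NN_le x
    have h2 := NN_nonneg x
    set n := (K:ℝ) * m
    have h3 : n * NN x ≤ n * n := mul_le_mul_of_nonneg_left h1 (by linarith)
    have h4 : n * n ≤ n ^ 3 := by nlinarith [mul_nonneg (by linarith : 0 ≤ n) (by linarith : 0 ≤ n)]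
    linarith

theorem SS_nonneg (H : Hyp K m a d c B α prof) {x : Fin K → Fin m → Bool}
    (hx : feasible K m a d c B α x) (hn : ¬ opt a d c B α prof x) :
    0 ≤ SS a d c B α prof x := by
  obtain ⟨f1, f2, f3, f4, f5⟩ := tau_facts H.hK H.hmono x (miss_of H hx hn)
  refine le_trans ?_ (SS_ge H hx hn rfl)
  exact Finset.sum_nonneg fun i' _ => Finset.sum_nonneg fun i _ => PT_nonneg H.hK f4 x i' i

theorem n_two (H : Hyp K m a d c B α prof) {x : Fin K → Fin m → Bool}
    (h : 1 ≤ SS a d c B α prof x) : (2:ℝ) ≤ (K:ℝ) * m := by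
  have hlt : 1 < K * m := by
    by_contra hcon
    have hc : Fintype.card (Fin K × Fin m) ≤ 1 := by simpa using hcon
    rw [Fintype.card_le_one_iff] at hc
    have : SS a d c B α prof x = 0 := by
      unfold SS
      refine Finset.sum_eq_zero fun s _ => Finset.sum_eq_zero fun t _ => ?_
      rw [if_neg]
      rintro ⟨h1, h2⟩
      rw [hc s t, h2] at h1
      exact absurd h1 (by simp)
    linarith
  exact_mod_cast hlt

open scoped Classical in
theorem drift_feas (H : Hyp K m a d c B α prof) {x : Fin K → Fin m → Bool}
    (hx : feasible K m a d c B α x) (hn : ¬ opt a d c B α prof x) :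
    1 ≤ 1 / (2 * (K * m : ℝ)) * ∑ p, (if fge K m a d c B α (fun _ j => prof j) (fl x p) x
          then PP a d c B α prof x - PP a d c B α prof (fl x p) else 0) +
      1 / ((K * m : ℝ) * ((K * m : ℝ) - 1)) * (1 / 2) *
      ∑ r ∈ (Finset.univ : Finset (Fin K × Fin m)).offDiag,
        (if fge K m a d c B α (fun _ j => prof j) (fl (fl x r.1) r.2) x
          then PP a d c B α prof x - PP a d c B α prof (fl (fl x r.1) r.2) else 0) := by
  have key : ∀ y, (if fge K m a d c B α (fun _ j => prof j) y x
          then PP a d c B α prof x - PP a d c B α prof y else 0) =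
          ((K:ℝ) * m) ^ 2 * DD a d c B α prof x y := by
    intro y
    unfold DD
    split_ifs with h
    · have yf := (of_acc H.h1 H.ha H.hd H.hc H.hprof hx h).1
      rw [PP_feas hx, PP_feas yf]
      unfold Tp
      rw [if_neg hn]
      ring
    · simp
  simp only [key]
  rw [← Finset.mul_sum, ← Finset.mul_sum]
  have hp := pair_ge H hx hn
  have hs := SS_nonneg H hx hn
  have h1 : 0 ≤ ∑ p, DD a d c B α prof x (fl x p) := Finset.sum_nonneg fun p _ => one_nn H hx hn p
  have hn1 := n_ge H
  have hpr := progress H hx hn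
  have h2n := n_two (x := x) H
  set S1 := ∑ p, DD a d c B α prof x (fl x p) with hS1
  set S2 := ∑ r ∈ (Finset.univ : Finset (Fin K × Fin m)).offDiag,
      DD a d c B α prof x (fl (fl x r.1) r.2)
  set n := (K:ℝ) * m
  have e1 : 1 / (2 * n) * (n ^ 2 * S1) = n / 2 * S1 := by field_simp
  have e2 : 0 ≤ 1 / (n * (n - 1)) * (1 / 2) := by
    have : 0 ≤ n - 1 := by linarith
    positivity
  have e3 : 0 ≤ 1 / (n * (n - 1)) * (1 / 2) * (n ^ 2 * S2) :=
    mul_nonneg e2 (mul_nonneg (by positivity) (by linarith))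
  rw [e1]
  rcases hpr with ⟨p, hp'⟩ | hss
  · have : 2 ≤ S1 := le_trans hp'
      (Finset.single_le_sum (f := fun p => DD a d c B α prof x (fl x p))
        (fun p _ => one_nn H hx hn p) (Finset.mem_univ p))
    nlinarith
  · have h2 := h2n hss
    have e4 : 1 / (n * (n - 1)) * (1 / 2) * (n ^ 2 * S2) = n / (n - 1) * (S2 / 2) := by
      have : n - 1 ≠ 0 := by intro h; linarith
      field_simp
    rw [e4]
    have e5 : 1 ≤ n / (n - 1) := by
      rw [le_div_iff₀ (by linarith)]; linarith
    have e6 : 1 ≤ S2 / 2 := by linarith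
    have : 0 ≤ n / 2 * S1 := mul_nonneg (by linarith) h1
    nlinarith

theorem zero_feas (H : Hyp K m a d c B α prof) {x : Fin K → Fin m → Bool}
    (h : ∀ p : Fin K × Fin m, x p.1 p.2 = false) : feasible K m a d c B α x := by
  have hx : ∀ i j, x i j = false := fun i j => h (i, j)
  have hN : NN x = 0 := by simp [NN, tot, lin, hx]
  have hQ : QQ x = 0 := by simp [QQ, lin, hx]
  unfold feasible chebBeta
  rw [var_eq, exp_eq, hN, hQ]
  simp [H.hB, H.h0.le]

theorem kk_one {x : Fin K → Fin m → Bool} (p : Fin K × Fin m) (hp : x p.1 p.2 = true) :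
    1 ≤ kk x p.1 := by
  have h := kk_fl x p p.1
  obtain ⟨n, hn'⟩ := kk_nat (fl x p) p.1
  rw [hn'] at h
  simp only [hp, if_true] at h
  have : (0:ℝ) ≤ n := by positivity
  linarith

theorem kk_nn (x : Fin K → Fin m → Bool) (i : Fin K) : 0 ≤ kk x i := by
  obtain ⟨n, h⟩ := kk_nat x i; rw [h]; positivity

/-- accepted moves from an infeasible state do not raise the potential -/
theorem inf_drop (H : Hyp K m a d c B α prof) {x y : Fin K → Fin m → Bool}
    (hx : ¬ feasible K m a d c B α x) (hxy : NN x < NN y → QQ x ≤ QQ y)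
    (hA : fge K m a d c B α (fun _ j => prof j) y x) :
    0 ≤ PP a d c B α prof x - PP a d c B α prof y := by
  have h := n_ge H
  rw [PP_inf hx]
  have hN := NN_nonneg x
  by_cases hy : feasible K m a d c B α y
  · have := (PP_bd H hy).2
    have : 0 ≤ 2 * ((K:ℝ) * m) * NN x := by positivity
    linarith
  · rw [PP_inf hy]
    have h1 := inf_of_acc H.h1 H.ha H.hd H.hc hx hy hA
    have h2 : NN y ≤ NN x := by
      by_contra hc
      exact h1 ⟨not_le.mp hc, hxy (not_le.mp hc)⟩
    have := mul_le_mul_of_nonneg_left h2 (by positivity : 0 ≤ 2 * ((K:ℝ) * m))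
    linarith

theorem one_mono (x : Fin K → Fin m → Bool) (p : Fin K × Fin m) (h : NN x < NN (fl x p)) :
    QQ x ≤ QQ (fl x p) := by
  have hk := kk_nn x p.1
  rw [NN_fl] at h
  rw [QQ_fl]
  split_ifs at h ⊢
  · linarith
  · linarith

theorem two_mono (x : Fin K → Fin m → Bool) (p q : Fin K × Fin m)
    (h : NN x < NN (fl (fl x p) q)) : QQ x ≤ QQ (fl (fl x p) q) := by
  have hk := kk_nn x p.1
  have hk' := kk_nn (fl x p) q.1
  rw [NN_fl, NN_fl] at h
  rw [QQ_fl, QQ_fl]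
  split_ifs at h ⊢ <;> linarith

open scoped Classical in
theorem drift_inf (H : Hyp K m a d c B α prof) {x : Fin K → Fin m → Bool}
    (hx : ¬ feasible K m a d c B α x) :
    1 ≤ 1 / (2 * (K * m : ℝ)) * ∑ p, (if fge K m a d c B α (fun _ j => prof j) (fl x p) x
          then PP a d c B α prof x - PP a d c B α prof (fl x p) else 0) +
      1 / ((K * m : ℝ) * ((K * m : ℝ) - 1)) * (1 / 2) *
      ∑ r ∈ (Finset.univ : Finset (Fin K × Fin m)).offDiag,
        (if fge K m a d c B α (fun _ j => prof j) (fl (fl x r.1) r.2) x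
          then PP a d c B α prof x - PP a d c B α prof (fl (fl x r.1) r.2) else 0) := by
  have hn1 := n_ge H
  have hs : ∃ s : Fin K × Fin m, x s.1 s.2 = true := by
    by_contra hcon
    push Not at hcon
    exact hx (zero_feas H fun p => by simpa using hcon p)
  obtain ⟨s, hs⟩ := hs
  have hk := kk_one s hs
  have hN : NN (fl x s) = NN x - 1 := by rw [NN_fl, if_pos hs]; ring
  have hQ : QQ (fl x s) ≤ QQ x := by rw [QQ_fl, if_pos hs]; linarith
  have hA := inf_acc (prof := prof) H.h1 H.ha H.hd H.hc H.hprof hx (by linarith) hQ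
  have hd : 2 * ((K:ℝ) * m) ≤ PP a d c B α prof x - PP a d c B α prof (fl x s) := by
    rw [PP_inf hx]
    by_cases hy : feasible K m a d c B α (fl x s)
    · have h1 := (PP_bd H hy).2
      have h2 := NN_nonneg (fl x s)
      have : 1 ≤ NN x := by linarith
      have := mul_le_mul_of_nonneg_left this (by positivity : 0 ≤ 2 * ((K:ℝ) * m))
      linarith
    · rw [PP_inf hy, hN]
      linarith
  have g1 : ∀ p, 0 ≤ (if fge K m a d c B α (fun _ j => prof j) (fl x p) x
          then PP a d c B α prof x - PP a d c B α prof (fl x p) else 0) := fun p => by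
    split_ifs with h
    · exact inf_drop H hx (one_mono x p) h
    · exact le_rfl
  have g2 : 0 ≤ ∑ r ∈ (Finset.univ : Finset (Fin K × Fin m)).offDiag,
        (if fge K m a d c B α (fun _ j => prof j) (fl (fl x r.1) r.2) x
          then PP a d c B α prof x - PP a d c B α prof (fl (fl x r.1) r.2) else 0) :=
    Finset.sum_nonneg fun r _ => by
      split_ifs with h
      · exact inf_drop H hx (two_mono x r.1 r.2) h
      · exact le_rfl
  have g3 := Finset.single_le_sum (fun p _ => g1 p) (Finset.mem_univ s)
  simp only [hA, if_true] at g3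
  have e2 : 0 ≤ 1 / (((K:ℝ) * m) * ((K:ℝ) * m - 1)) * (1 / 2) := by
    have : 0 ≤ (K:ℝ) * m - 1 := by linarith
    positivity
  have e3 := mul_nonneg e2 g2
  have e4 := mul_le_mul_of_nonneg_left (hd.trans g3)
    (by positivity : 0 ≤ 1 / (2 * ((K:ℝ) * m)))
  have e5 : 1 / (2 * ((K:ℝ) * m)) * (2 * ((K:ℝ) * m)) = 1 :=
    one_div_mul_cancel (by intro h; linarith)
  linarith

end final

/-- RLS on the mirrored-profit instance (all groups share the same nonincreasing,
nonnegative profit profile `prof`): there is an absolute constant `C > 0` such that, for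
any group structure, parameters and mirrored profits, and from every initial solution,
the expected number of iterations until the current solution is, for the first time, a
feasible solution of maximal profit among all feasible solutions is at most `C·n³`. -/
theorem RLS_mirrored_profit_optimization :
    ∃ C : ℝ, 0 < C ∧
      ∀ (K m : ℕ), 1 ≤ K → 1 ≤ m →
      ∀ (a d c B α : ℝ), 0 < a → 0 < d → 0 < c → 0 < B → 0 < α → α < 1 →
      ∀ (prof : Fin m → ℝ), (∀ j, 0 ≤ prof j) →
        (∀ j j' : Fin m, j ≤ j' → prof j' ≤ prof j) →
      ∀ x₀ : Fin K → Fin m → Bool,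
        expHitTime K m
            (stepP K m (mutRLS K m) (fge K m a d c B α (fun _ j => prof j)))
            (fun y => feasible K m a d c B α y ∧
              ∀ z, feasible K m a d c B α z →
                profitOf K m (fun _ j => prof j) z ≤
                  profitOf K m (fun _ j => prof j) y) x₀ ≤
          ENNReal.ofReal (C * (K * m : ℝ) ^ 3) := by
  refine ⟨118, by norm_num, ?_⟩
  intro K m hK hm a d c B α ha hd hc hB h0 h1 prof hprof hmono x₀
  have H : Hyp K m a d c B α prof := ⟨hK, hm, ha, hd, hc, hB, h0, h1, hprof, hmono⟩
  refine le_trans (rls_drift K m hK hm _ (opt a d c B α prof) (PP a d c B α prof) (PP_nonneg H) ?_ x₀)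
    (ENNReal.ofReal_le_ofReal (PP_le H x₀))
  intro x hx
  by_cases hf : feasible K m a d c B α x
  · exact drift_feas H hf hx
  · exact drift_inf H hf
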